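/- arXiv:2203.01096 — 8 statements merged into one kernel-verified Lean document; each statement's English description precedes it below -/
import Mathlib

section
/- Let D = (V ∪ {s}, A) be a pre-flow directed graph, i.e., no arc enters s and d^-_D(v) ≥ d^+_D(v) for all v ∈ V. Then there exists a packing of s-arborescences such that each vertex v ∈ V belongs to at least λ_D(s,v) of them. -/
/-- A directed graph (possibly with parallel arcs): arc type `At`, vertex type `Vt`,
each arc has a tail and a head. -/
structure Dgraph (Vt At : Type) where
  tail : At → Vt
  head : At → Vt

namespace Dgraph

variable {Vt At : Type}

/-- `D.WalkFrom u p v` : the list of arcs `p` forms a directed walk from `u` to `v`. -/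
def WalkFrom (D : Dgraph Vt At) : Vt → List At → Vt → Prop
  | u, [], v => u = v
  | u, a :: p, v => D.tail a = u ∧ D.WalkFrom (D.head a) p v

/-- The vertices visited by a walk starting at `u` with arc list `p`. -/
def walkVerts (D : Dgraph Vt At) (u : Vt) (p : List At) : List Vt :=
  u :: p.map D.head

/-- A directed path from `u` to `v`: a walk visiting pairwise distinct vertices. -/
def IsPath (D : Dgraph Vt At) (u : Vt) (p : List At) (v : Vt) : Prop :=
  D.WalkFrom u p v ∧ (D.walkVerts u p).Nodup

/-- An arc list is τ-respecting if its τ-values are non-decreasing. -/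
def Respects (τ : At → ℕ) (p : List At) : Prop :=
  List.Chain' (· ≤ ·) (p.map τ)

/-- An arc list is monochromatic w.r.t. a colouring `c` if all its arcs get the same colour. -/
def Monochromatic (c : At → Bool) (p : List At) : Prop :=
  ∀ a ∈ p, ∀ b ∈ p, c a = c b

/-- There is no directed cycle using only arcs of `B`
(equivalently, no nonempty closed directed walk inside `B`). -/
def AcyclicOn (D : Dgraph Vt At) (B : Set At) : Prop :=
  ¬ ∃ (v : Vt) (p : List At), p ≠ [] ∧ (∀ a ∈ p, a ∈ B) ∧ D.WalkFrom v p v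

/-- The directed graph contains no directed cycle. -/
def Acyclic (D : Dgraph Vt At) : Prop :=
  D.AcyclicOn Set.univ

/-- `u` reaches `v` by a directed walk. -/
def Reaches (D : Dgraph Vt At) (u v : Vt) : Prop :=
  ∃ p : List At, D.WalkFrom u p v

/-- `u` and `v` are in the same strongly connected component. -/
def MutuallyReachable (D : Dgraph Vt At) (u v : Vt) : Prop :=
  D.Reaches u v ∧ D.Reaches v u

/-- A temporal network `(D, τ)` is consistent if any two arcs lying in the same strongly
connected component (i.e. whose endpoints are all mutually reachable) have the same τ-value. -/
def Consistent (D : Dgraph Vt At) (τ : At → ℕ) : Prop :=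
  ∀ a b : At,
    D.MutuallyReachable (D.tail a) (D.head a) →
    D.MutuallyReachable (D.tail b) (D.head b) →
    D.MutuallyReachable (D.tail a) (D.tail b) →
    τ a = τ b

section Fin

variable [DecidableEq Vt] [Fintype At]

/-- The vertex set of the subgraph with arc set `B`, together with the root `s`. -/
def vertsF (D : Dgraph Vt At) (s : Vt) (B : Finset At) : Finset Vt :=
  insert s (B.image D.tail ∪ B.image D.head)

/-- In-degree of `v` in the subgraph with arc set `B`. -/
def indegOn (D : Dgraph Vt At) (B : Finset At) (v : Vt) : ℕ :=
  (B.filter (fun a => D.head a = v)).card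

/-- In-degree of `v`. -/
def indeg (D : Dgraph Vt At) (v : Vt) : ℕ :=
  D.indegOn Finset.univ v

/-- Out-degree of `v`. -/
def outdeg (D : Dgraph Vt At) (v : Vt) : ℕ :=
  (Finset.univ.filter (fun a => D.tail a = v)).card

/-- `ρ^i_N(v)` : the set of arcs entering `v` with τ-value at most `i`. -/
def rhoLe (D : Dgraph Vt At) (τ : At → ℕ) (v : Vt) (i : ℕ) : Finset At :=
  Finset.univ.filter (fun a => D.head a = v ∧ τ a ≤ i)

/-- `δ^i_N(v)` : the set of arcs leaving `v` with τ-value at most `i`. -/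
def deltaLe (D : Dgraph Vt At) (τ : At → ℕ) (v : Vt) (i : ℕ) : Finset At :=
  Finset.univ.filter (fun a => D.tail a = v ∧ τ a ≤ i)

/-- The temporal network `(D, τ)` with root `s` is pre-flow:
`|ρ^i_N(v)| ≥ |δ^i_N(v)|` for every `i` and every non-root vertex `v`. -/
def Preflow (D : Dgraph Vt At) (τ : At → ℕ) (s : Vt) : Prop :=
  ∀ (i : ℕ) (v : Vt), v ≠ s → (D.deltaLe τ v i).card ≤ (D.rhoLe τ v i).card

/-- The arc set `B` induces an `s`-arborescence: the subgraph contains `s`,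
has no directed cycle, and every vertex of it other than `s` has in-degree exactly 1. -/
def IsArb (D : Dgraph Vt At) (s : Vt) (B : Finset At) : Prop :=
  D.AcyclicOn (↑B) ∧ ∀ v ∈ D.vertsF s B, v ≠ s → D.indegOn B v = 1

/-- The arc set `B` induces a τ-respecting `s`-arborescence: an `s`-arborescence in which,
for every vertex `v` of the arborescence, the (unique) path from `s` to `v` is τ-respecting. -/
def IsTArb (D : Dgraph Vt At) (τ : At → ℕ) (s : Vt) (B : Finset At) : Prop :=
  D.IsArb s B ∧
    ∀ v ∈ D.vertsF s B, ∀ p : List At, (∀ a ∈ p, a ∈ B) → D.IsPath s p v → Respects τ p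

/-- There exist `k` pairwise arc-disjoint τ-respecting directed paths from `s` to `v`. -/
def HasTPaths (D : Dgraph Vt At) (τ : At → ℕ) (s v : Vt) (k : ℕ) : Prop :=
  ∃ P : Fin k → List At,
    (∀ i, D.IsPath s (P i) v ∧ Respects τ (P i)) ∧
    ∀ i j, i ≠ j → ∀ a, a ∈ P i → a ∉ P j

/-- `λ_N(s,v)` : the maximum number of pairwise arc-disjoint τ-respecting `(s,v)`-paths. -/
noncomputable def lambdaT (D : Dgraph Vt At) (τ : At → ℕ) (s v : Vt) : ℕ :=
  sSup {k | D.HasTPaths τ s v k}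

/-- `λ_D(s,v)` : the maximum number of pairwise arc-disjoint `(s,v)`-paths. -/
noncomputable def lambda (D : Dgraph Vt At) (s v : Vt) : ℕ :=
  D.lambdaT (fun _ => 0) s v

end Fin

end Dgraph

namespace Dgraph

open Finset

variable {Vt At : Type}

/-- `v` is reachable from `s` along arcs of `B`. -/
def ReachesOn (D : Dgraph Vt At) (B : Finset At) (s v : Vt) : Prop :=
  Relation.ReflTransGen (fun x y => ∃ a ∈ B, D.tail a = x ∧ D.head a = y) s v

/-- Replace the arc `e` by an arc from the tail of `e` to the head of `f`. -/
def split [DecidableEq At] (D : Dgraph Vt At) (e f : At) : Dgraph Vt At where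
  tail := D.tail
  head := Function.update D.head e (D.head f)

section Reachability

variable {D : Dgraph Vt At} {B C : Finset At} {s v : Vt}

theorem ReachesOn.mono (h : B ⊆ C) (hv : D.ReachesOn B s v) : D.ReachesOn C s v :=
  Relation.ReflTransGen.mono (fun _ _ ⟨a, ha, h'⟩ => ⟨a, h ha, h'⟩) _ _ hv

theorem ReachesOn.snoc {a : At} (ha : a ∈ B) (h : D.ReachesOn B s (D.tail a)) :
    D.ReachesOn B s (D.head a) :=
  Relation.ReflTransGen.tail h ⟨a, ha, rfl, rfl⟩

theorem ReachesOn.exists_last (h : D.ReachesOn B s v) (hv : v ≠ s) :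
    ∃ a ∈ B, D.ReachesOn B s (D.tail a) ∧ D.head a = v := by
  rcases Relation.ReflTransGen.cases_tail h with h | ⟨u, hu, a, ha, rfl, rfl⟩
  · exact absurd h hv
  · exact ⟨a, ha, hu, rfl⟩

/-- Reachable vertices can be ranked so that each is entered from a vertex of smaller rank. -/
theorem exists_rank (D : Dgraph Vt At) (B : Finset At) (s : Vt) :
    ∃ d : Vt → ℕ, ∀ v, D.ReachesOn B s v → v ≠ s →
      ∃ a ∈ B, D.ReachesOn B s (D.tail a) ∧ D.head a = v ∧ d (D.tail a) < d v := by
  classical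
  let N : ℕ → Vt → Prop := fun n => Nat.rec (fun v => v = s)
    (fun _ P v => ∃ a ∈ B, P (D.tail a) ∧ D.head a = v) n
  have hN : ∀ n v, N n v → D.ReachesOn B s v := by
    intro n
    induction n with
    | zero => intro v hv; exact (show v = s from hv) ▸ Relation.ReflTransGen.refl
    | succ n ih => rintro v ⟨a, ha, h, rfl⟩; exact (ih _ h).snoc ha
  have hex : ∀ v, D.ReachesOn B s v → ∃ n, N n v := by
    intro v h
    induction h with
    | refl => exact ⟨0, rfl⟩
    | tail _ hab ih =>
      obtain ⟨n, hn⟩ := ih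
      obtain ⟨a, ha, rfl, rfl⟩ := hab
      exact ⟨n + 1, a, ha, hn, rfl⟩
  refine ⟨fun v => sInf {n | N n v}, fun v hv hvs => ?_⟩
  have hmem : N (sInf {n | N n v}) v := Nat.sInf_mem (hex v hv)
  cases hn : sInf {n | N n v} with
  | zero => rw [hn] at hmem; exact absurd hmem hvs
  | succ n =>
    rw [hn] at hmem
    obtain ⟨a, ha, h, h'⟩ := hmem
    refine ⟨a, ha, hN _ _ h, h', ?_⟩
    dsimp only
    rw [hn]
    exact Nat.lt_succ_of_le (Nat.sInf_le h)

theorem WalkFrom.rank_le {d : Vt → ℕ} (hd : ∀ a ∈ B, d (D.tail a) < d (D.head a)) :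
    ∀ {p : List At} {u : Vt}, (∀ a ∈ p, a ∈ B) → D.WalkFrom u p v → d u + p.length ≤ d v := by
  intro p
  induction p with
  | nil => rintro u - rfl; simp
  | cons a p ih =>
    rintro u hp ⟨rfl, hw⟩
    have h1 := ih (fun b hb => hp b (List.mem_cons_of_mem _ hb)) hw
    have h2 := hd a (hp a List.mem_cons_self)
    simp only [List.length_cons]
    omega

/-- The vertices reachable inside `B` are spanned by an arborescence contained in `B`. -/
theorem exists_isArb_subset [DecidableEq Vt] [Fintype At]
    (hroot : ∀ a ∈ B, D.head a ≠ s) :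
    ∃ C ⊆ B, D.IsArb s C ∧ (∀ v, D.ReachesOn B s v → D.ReachesOn C s v) ∧
      (∀ a ∈ C, D.ReachesOn C s (D.head a)) ∧
      ∀ a ∈ C, ∀ b ∈ C, D.head a = D.head b → a = b := by
  classical
  obtain ⟨d, hd⟩ := D.exists_rank B s
  choose p hpB hpR hph hpd using hd
  let C := B.filter (fun a => ∃ h h', p (D.head a) h h' = a)
  have hCB : C ⊆ B := filter_subset _ _
  have hC : ∀ v, D.ReachesOn B s v → D.ReachesOn C s v := by
    intro v
    induction hn : d v using Nat.strong_induction_on generalizing v with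
    | _ n ih =>
      intro hv
      by_cases hvs : v = s
      · subst hvs; exact Relation.ReflTransGen.refl
      · have hmem : p v hv hvs ∈ C := by
          refine mem_filter.2 ⟨hpB v hv hvs, ?_⟩
          simp only [hph v hv hvs]
          exact ⟨hv, hvs, trivial⟩
        have h := (ih _ (hn ▸ hpd v hv hvs) _ rfl (hpR v hv hvs)).snoc hmem
        rwa [hph v hv hvs] at h
  have hprop : ∀ a ∈ C, ∃ h h', p (D.head a) h h' = a := fun a ha => (mem_filter.1 ha).2
  have hrank : ∀ a ∈ C, d (D.tail a) < d (D.head a) := by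
    intro a ha
    obtain ⟨h1, h2, h3⟩ := hprop a ha
    have h := hpd _ h1 h2
    rwa [h3] at h
  have htail : ∀ a ∈ C, D.ReachesOn C s (D.tail a) := by
    intro a ha
    obtain ⟨h1, h2, h3⟩ := hprop a ha
    have h := hpR _ h1 h2
    rw [h3] at h
    exact hC _ h
  have huniq : ∀ a ∈ C, ∀ b ∈ C, D.head a = D.head b → a = b := by
    intro a ha b hb hab
    obtain ⟨_, _, h1⟩ := hprop a ha
    obtain ⟨_, _, h2⟩ := hprop b hb
    rw [← h1, ← h2]
    simp only [hab]
  refine ⟨C, hCB, ⟨?_, ?_⟩, hC, fun a ha => (htail a ha).snoc ha, huniq⟩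
  · rintro ⟨v, q, hq, hqC, hw⟩
    have := hw.rank_le (B := C) hrank (fun a ha => by simpa using hqC a ha)
    have := List.length_pos_of_ne_nil hq
    omega
  · intro v hv hvs
    have hreach : D.ReachesOn C s v := by
      simp only [vertsF, mem_insert, mem_union, mem_image] at hv
      rcases hv with rfl | ⟨a, ha, rfl⟩ | ⟨a, ha, rfl⟩
      · exact absurd rfl hvs
      · exact htail a ha
      · exact (htail a ha).snoc ha
    obtain ⟨a, ha, -, rfl⟩ := hreach.exists_last hvs
    rw [indegOn, card_eq_one]
    refine ⟨a, ?_⟩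
    ext b
    simp only [mem_filter, mem_singleton]
    exact ⟨fun h => huniq b h.1 a ha h.2, by rintro rfl; exact ⟨ha, rfl⟩⟩

theorem mem_vertsF_of_reachesOn [DecidableEq Vt] [Fintype At] (h : D.ReachesOn B s v) :
    v ∈ D.vertsF s B := by
  by_cases hv : v = s
  · simp [vertsF, hv]
  · obtain ⟨a, ha, -, rfl⟩ := h.exists_last hv
    simp only [vertsF, mem_insert, mem_union, mem_image]
    exact Or.inr (Or.inr ⟨a, ha, rfl⟩)

/-- Undoing a splitting-off keeps everything reachable. -/
theorem ReachesOn.of_split [DecidableEq At] {e f : At} (hef : D.head e = D.tail f)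
    (h : (D.split e f).ReachesOn B s v) :
    D.ReachesOn (if e ∈ B then insert f B else B) s v := by
  induction h with
  | refl => exact Relation.ReflTransGen.refl
  | tail _ hab ih =>
    obtain ⟨a, ha, rfl, rfl⟩ := hab
    by_cases hae : a = e
    · subst hae
      have hf : f ∈ insert f B := mem_insert_self f B
      rw [if_pos ha] at ih ⊢
      have h1 : D.ReachesOn (insert f B) s (D.tail f) :=
        hef ▸ ReachesOn.snoc (mem_insert_of_mem ha) ih
      simpa [split] using h1.snoc hf
    · have h1 : a ∈ if e ∈ B then insert f B else B := by
        split_ifs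
        · exact mem_insert_of_mem ha
        · exact ha
      simpa [split, hae] using ReachesOn.snoc h1 ih

/-- A family of arc-disjoint subsets of `A` such that `r v` of them reach `v`. -/
def Packs (D : Dgraph Vt At) (A : Finset At) (s : Vt) (r : Vt → ℕ) {k : ℕ}
    (B : Fin k → Finset At) : Prop :=
  (∀ i, B i ⊆ A) ∧ (∀ i j, i ≠ j → Disjoint (B i) (B j)) ∧
    ∀ v, v ≠ s → ∃ I : Finset (Fin k), (∀ i ∈ I, D.ReachesOn (B i) s v) ∧ r v ≤ #I

theorem Packs.of_split [DecidableEq At] {A : Finset At} {r : Vt → ℕ} {e f : At} (hf : f ∈ A)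
    (hef : D.head e = D.tail f) {k : ℕ} {B : Fin k → Finset At}
    (h : (D.split e f).Packs (A.erase f) s r B) :
    ∃ C : Fin k → Finset At, D.Packs A s r C := by
  obtain ⟨hA, hdis, hr⟩ := h
  have hfB : ∀ i, f ∉ B i := fun i hi => by simpa using hA i hi
  refine ⟨fun i => if e ∈ B i then insert f (B i) else B i, fun i => ?_, fun i j hij => ?_,
    fun v hv => ?_⟩
  · have := (hA i).trans (erase_subset f A)
    dsimp only
    split_ifs
    · exact insert_subset hf this
    · exact this
  · have h1 := disjoint_left.1 (hdis i j hij)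
    rw [disjoint_left]
    intro a
    have h2 := hfB i
    have h3 := hfB j
    dsimp only
    split_ifs <;> grind
  · obtain ⟨I, hI, hrI⟩ := hr v hv
    exact ⟨I, fun i hi => (hI i hi).of_split hef, hrI⟩

end Reachability

section Cuts

variable [DecidableEq Vt]

/-- The number of arcs of `A` entering `X`. -/
def cutIn (D : Dgraph Vt At) (A : Finset At) (X : Finset Vt) : ℕ :=
  ∑ a ∈ A, if D.head a ∈ X ∧ D.tail a ∉ X then 1 else 0

/-- On the arc set `A`, every vertex other than `s` is entered at least as often as left. -/
def PreflowOn (D : Dgraph Vt At) (A : Finset At) (s : Vt) : Prop :=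
  ∀ v, v ≠ s → (∑ a ∈ A, if D.tail a = v then 1 else 0) ≤ ∑ a ∈ A, if D.head a = v then 1 else 0

/-- Every cut separating a vertex `x` from `s` has at least `r x` arcs of `A`. -/
def Demand (D : Dgraph Vt At) (A : Finset At) (s : Vt) (r : Vt → ℕ) : Prop :=
  ∀ X, s ∉ X → ∀ x ∈ X, r x ≤ D.cutIn A X

/-- `X` is a cut meeting one of its positive demands with equality. -/
def Tight (D : Dgraph Vt At) (A : Finset At) (s : Vt) (r : Vt → ℕ) (X : Finset Vt) : Prop :=
  s ∉ X ∧ ∃ x ∈ X, 0 < r x ∧ D.cutIn A X ≤ r x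

variable {D : Dgraph Vt At} {A : Finset At} {s : Vt} {r : Vt → ℕ}

theorem PreflowOn.sum_le (h : D.PreflowOn A s) {Z : Finset Vt} (hZ : s ∉ Z) :
    (∑ a ∈ A, if D.tail a ∈ Z then 1 else 0) ≤ ∑ a ∈ A, if D.head a ∈ Z then 1 else 0 := by
  have key : ∀ g : At → Vt, (∑ a ∈ A, if g a ∈ Z then 1 else 0) =
      ∑ z ∈ Z, ∑ a ∈ A, if g a = z then 1 else 0 := by
    intro g
    rw [sum_comm]
    exact sum_congr rfl fun a _ => by rw [sum_ite_eq]
  rw [key, key]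
  exact sum_le_sum fun z hz => h z (fun hzs => hZ (hzs ▸ hz))

theorem cutIn_inter_add_cutIn_union_le (D : Dgraph Vt At) (A : Finset At) (X Y : Finset Vt) :
    D.cutIn A (X ∩ Y) + D.cutIn A (X ∪ Y) ≤ D.cutIn A X + D.cutIn A Y := by
  simp only [cutIn, ← sum_add_distrib]
  exact sum_le_sum fun a _ => by grind

theorem cutIn_inter_add_cutIn_union_lt {X Y : Finset Vt} {f : At} (hf : f ∈ A)
    (h1 : D.tail f ∈ Y) (h2 : D.tail f ∉ X) (h3 : D.head f ∈ X) (h4 : D.head f ∉ Y) :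
    D.cutIn A (X ∩ Y) + D.cutIn A (X ∪ Y) < D.cutIn A X + D.cutIn A Y := by
  simp only [cutIn, ← sum_add_distrib]
  exact sum_lt_sum (fun a _ => by grind) ⟨f, hf, by grind⟩

theorem PreflowOn.cutIn_sdiff_add_le (h : D.PreflowOn A s) {X Y : Finset Vt} (hX : s ∉ X) :
    D.cutIn A (X \ Y) + D.cutIn A (Y \ X) ≤ D.cutIn A X + D.cutIn A Y := by
  have h1 := h.sum_le (Z := X ∩ Y) (by grind)
  have h2 : ∑ a ∈ A, ((if D.head a ∈ X \ Y ∧ D.tail a ∉ X \ Y then 1 else 0) +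
      (if D.head a ∈ Y \ X ∧ D.tail a ∉ Y \ X then 1 else 0) +
      (if D.head a ∈ X ∩ Y then 1 else 0)) ≤
      ∑ a ∈ A, ((if D.head a ∈ X ∧ D.tail a ∉ X then 1 else 0) +
      (if D.head a ∈ Y ∧ D.tail a ∉ Y then 1 else 0) +
      (if D.tail a ∈ X ∩ Y then 1 else 0)) := sum_le_sum fun a _ => by grind
  simp only [sum_add_distrib] at h2
  simp only [cutIn]
  omega

theorem PreflowOn.cutIn_sdiff_add_lt (h : D.PreflowOn A s) {X Y : Finset Vt} (hX : s ∉ X)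
    {f : At} (hf : f ∈ A)
    (hfXY : (D.head f ∈ X ∩ Y ∧ D.tail f ∉ X ∪ Y) ∨ (D.tail f ∈ X ∩ Y ∧ D.head f ∉ X ∪ Y)) :
    D.cutIn A (X \ Y) + D.cutIn A (Y \ X) < D.cutIn A X + D.cutIn A Y := by
  have h1 := h.sum_le (Z := X ∩ Y) (by grind)
  have h2 : ∑ a ∈ A, ((if D.head a ∈ X \ Y ∧ D.tail a ∉ X \ Y then 1 else 0) +
      (if D.head a ∈ Y \ X ∧ D.tail a ∉ Y \ X then 1 else 0) +
      (if D.head a ∈ X ∩ Y then 1 else 0)) <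
      ∑ a ∈ A, ((if D.head a ∈ X ∧ D.tail a ∉ X then 1 else 0) +
      (if D.head a ∈ Y ∧ D.tail a ∉ Y then 1 else 0) +
      (if D.tail a ∈ X ∩ Y then 1 else 0)) :=
    sum_lt_sum (fun a _ => by grind) ⟨f, hf, by grind⟩
  simp only [sum_add_distrib] at h2
  simp only [cutIn]
  omega

/-- Two tight sets can be uncrossed: either intersection and union, or both differences,
are tight, and the corresponding submodular inequality holds with equality. -/
theorem Tight.uncross (hpre : D.PreflowOn A s) (hdem : D.Demand A s r) {X Y : Finset Vt}
    (hX : D.Tight A s r X) (hY : D.Tight A s r Y) :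
    (D.Tight A s r (X ∩ Y) ∧ D.Tight A s r (X ∪ Y) ∧
      D.cutIn A X + D.cutIn A Y ≤ D.cutIn A (X ∩ Y) + D.cutIn A (X ∪ Y)) ∨
    (D.Tight A s r (X \ Y) ∧ D.Tight A s r (Y \ X) ∧
      D.cutIn A X + D.cutIn A Y ≤ D.cutIn A (X \ Y) + D.cutIn A (Y \ X)) := by
  obtain ⟨hsX, x, hx, hrx, hcx⟩ := hX
  obtain ⟨hsY, y, hy, hry, hcy⟩ := hY
  have hsI : s ∉ X ∩ Y := by grind
  have hsU : s ∉ X ∪ Y := by grind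
  have hsub := D.cutIn_inter_add_cutIn_union_le A X Y
  by_cases hxY : x ∈ Y
  · have h1 := hdem (X ∩ Y) hsI x (by grind)
    have h2 := hdem (X ∪ Y) hsU y (by grind)
    exact Or.inl ⟨⟨hsI, x, by grind, hrx, by omega⟩, ⟨hsU, y, by grind, hry, by omega⟩, by omega⟩
  by_cases hyX : y ∈ X
  · have h1 := hdem (X ∩ Y) hsI y (by grind)
    have h2 := hdem (X ∪ Y) hsU x (by grind)
    exact Or.inl ⟨⟨hsI, y, by grind, hry, by omega⟩, ⟨hsU, x, by grind, hrx, by omega⟩, by omega⟩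
  have hsD : s ∉ X \ Y := by grind
  have hsE : s ∉ Y \ X := by grind
  have hdiff := hpre.cutIn_sdiff_add_le (Y := Y) hsX
  have h1 := hdem (X \ Y) hsD x (by grind)
  have h2 := hdem (Y \ X) hsE y (by grind)
  exact Or.inr ⟨⟨hsD, x, by grind, hrx, by omega⟩, ⟨hsE, y, by grind, hry, by omega⟩, by omega⟩

/-- For every arc `f` leaving a vertex without demand there is an arc `e` entering that vertex
such that no tight set obstructs splitting off the pair `e, f`. -/
theorem exists_unobstructed [Fintype Vt] (hpre : D.PreflowOn A s) (hdem : D.Demand A s r) {f : At}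
    (hf : f ∈ A) (hloop : D.head f ≠ D.tail f) (hs : D.tail f ≠ s) (hr : r (D.tail f) = 0) :
    ∃ e ∈ A, D.head e = D.tail f ∧ ∀ X, D.Tight A s r X →
      (D.head f ∈ X → D.tail f ∉ X → D.tail e ∉ X) ∧
      (D.head f ∉ X → D.tail f ∈ X → D.tail e ∈ X) := by
  classical
  set v := D.tail f with hv
  set t := D.head f with ht
  let P : Finset Vt → Prop := fun X => D.Tight A s r X ∧ t ∈ X ∧ v ∉ X
  let Q : Finset Vt → Prop := fun X => D.Tight A s r X ∧ t ∉ X ∧ v ∈ X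
  have hP : ∀ X Y, P X → P Y → P (X ∪ Y) := by
    rintro X Y ⟨hX, htX, hvX⟩ ⟨hY, htY, hvY⟩
    rcases hX.uncross hpre hdem hY with ⟨-, h, -⟩ | ⟨-, -, h⟩
    · exact ⟨h, by grind, by grind⟩
    · have := hpre.cutIn_sdiff_add_lt (X := X) (Y := Y) hX.1 hf (by grind)
      omega
  have hQ : ∀ X Y, Q X → Q Y → Q (X ∩ Y) := by
    rintro X Y ⟨hX, htX, hvX⟩ ⟨hY, htY, hvY⟩
    rcases hX.uncross hpre hdem hY with ⟨h, -, -⟩ | ⟨-, -, h⟩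
    · exact ⟨h, by grind, by grind⟩
    · have := hpre.cutIn_sdiff_add_lt (X := X) (Y := Y) hX.1 hf (by grind)
      omega
  obtain ⟨M, hM, hMmax⟩ : ∃ M, (M = ∅ ∨ P M) ∧ ∀ X, P X → X ⊆ M := by
    refine ⟨(univ.filter P).sup id, ?_, fun X hX => ?_⟩
    · refine sup_induction (p := fun M => M = ∅ ∨ P M) (Or.inl rfl) ?_ ?_
      · rintro X (rfl | hX) Y (rfl | hY)
        · exact Or.inl (by simp)
        · exact Or.inr (by simpa using hY)
        · exact Or.inr (by simpa using hX)
        · exact Or.inr (hP X Y hX hY)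
      · exact fun X hX => Or.inr (mem_filter.1 hX).2
    · exact le_sup (f := id) (mem_filter.2 ⟨mem_univ X, hX⟩)
  obtain ⟨N, hN, hNmin⟩ : ∃ N, (N = univ ∨ Q N) ∧ ∀ X, Q X → N ⊆ X := by
    refine ⟨(univ.filter Q).inf id, ?_, fun X hX => ?_⟩
    · refine inf_induction (p := fun M => M = univ ∨ Q M) (Or.inl rfl) ?_ ?_
      · rintro X (rfl | hX) Y (rfl | hY)
        · exact Or.inl (by simp)
        · exact Or.inr (by simpa using hY)
        · exact Or.inr (by simpa using hX)
        · exact Or.inr (hQ X Y hX hY)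
      · exact fun X hX => Or.inr (mem_filter.1 hX).2
    · exact inf_le (f := id) (mem_filter.2 ⟨mem_univ X, hX⟩)
  -- the entering arcs cannot all come from a set of type `P`
  have hP' : P M → ∃ e ∈ A, D.head e = v ∧ D.tail e ∉ M := by
    rintro ⟨⟨hsM, x, hx, hrx, hcx⟩, htM, hvM⟩
    by_contra! hcon
    have h1 := hdem (insert v M) (by grind) x (by grind)
    have h2 : D.cutIn A (insert v M) < D.cutIn A M :=
      sum_lt_sum (fun a ha => by have := hcon a ha; grind) ⟨f, hf, by grind⟩
    omega
  -- the entering arcs cannot all come from outside a set of type `Q`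
  have hQ' : Q N → ∃ e ∈ A, D.head e = v ∧ D.tail e ∈ N := by
    rintro ⟨⟨hsN, x, hx, hrx, hcx⟩, htN, hvN⟩
    by_contra! hcon
    have h1 := hdem (N.erase v) (by grind) x (by grind)
    have h2 : ∑ a ∈ A, ((if D.head a ∈ N.erase v ∧ D.tail a ∉ N.erase v then 1 else 0) +
        (if D.head a = v then 1 else 0)) <
        ∑ a ∈ A, ((if D.head a ∈ N ∧ D.tail a ∉ N then 1 else 0) +
        (if D.tail a = v then 1 else 0)) :=
      sum_lt_sum (fun a ha => by have := hcon a ha; grind) ⟨f, hf, by grind⟩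
    simp only [sum_add_distrib] at h2
    have h3 := hpre v hs
    simp only [cutIn] at h1 hcx
    omega
  obtain ⟨e, he, hev, heM, heN⟩ : ∃ e ∈ A, D.head e = v ∧ D.tail e ∉ M ∧ D.tail e ∈ N := by
    rcases hM with rfl | hM <;> rcases hN with rfl | hN
    · by_contra! hcon
      have h1 : ∑ a ∈ A, (if D.head a = v then 1 else 0) = 0 :=
        sum_eq_zero fun a ha => by have := hcon a ha; grind
      have h2 := hpre v hs
      have h3 := single_le_sum (f := fun a => if D.tail a = v then 1 else 0)
        (fun _ _ => Nat.zero_le _) hf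
      simp only [← hv, if_true] at h3
      omega
    · simpa using hQ' hN
    · simpa using hP' hM
    · obtain ⟨e, he, hev, heN⟩ := hQ' hN
      refine ⟨e, he, hev, fun heM => ?_, heN⟩
      rcases hM.1.uncross hpre hdem hN.1 with ⟨-, -, h⟩ | ⟨-, h, -⟩
      · have := cutIn_inter_add_cutIn_union_lt (X := M) (Y := N) hf hN.2.2 hM.2.2 hM.2.1 hN.2.1
        omega
      · have := hNmin (N \ M) ⟨h, by grind, by grind⟩ heN
        grind
  refine ⟨e, he, hev, fun X hX => ⟨fun h1 h2 h3 => heM (hMmax X ⟨hX, h1, h2⟩ h3),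
    fun h1 h2 => hNmin X ⟨hX, h1, h2⟩ heN⟩⟩

theorem sum_erase_split [DecidableEq At] {e f : At} (he : e ∈ A) (hf : f ∈ A) (hef : e ≠ f)
    (g g' : At → ℕ) (hg : ∀ a, a ≠ e → g' a = g a) :
    ∑ a ∈ A.erase f, g' a + (g e + g f) = ∑ a ∈ A, g a + g' e := by
  have he' : e ∈ A.erase f := mem_erase.2 ⟨hef, he⟩
  rw [← add_sum_erase A g hf, ← add_sum_erase _ g he', ← add_sum_erase _ g' he',
    sum_congr rfl fun a ha => hg a (ne_of_mem_erase ha)]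
  ring

/-- Splitting off a suitable pair at a vertex without demand. -/
theorem exists_split [Fintype Vt] [DecidableEq At] (hroot : ∀ a ∈ A, D.head a ≠ s)
    (hpre : D.PreflowOn A s) (hdem : D.Demand A s r) {f : At}
    (hf : f ∈ A) (hloop : D.head f ≠ D.tail f) (hs : D.tail f ≠ s) (hr : r (D.tail f) = 0) :
    ∃ e ∈ A, D.head e = D.tail f ∧ (∀ a ∈ A.erase f, (D.split e f).head a ≠ s) ∧
      (D.split e f).PreflowOn (A.erase f) s ∧ (D.split e f).Demand (A.erase f) s r := by
  obtain ⟨e, he, hev, hX⟩ := exists_unobstructed hpre hdem hf hloop hs hr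
  have hef : e ≠ f := by rintro rfl; exact hloop hev
  have hhe : (D.split e f).head e = D.head f := by simp [split]
  have hha : ∀ a, a ≠ e → (D.split e f).head a = D.head a := fun a ha => by simp [split, ha]
  have hta : (D.split e f).tail = D.tail := rfl
  refine ⟨e, he, hev, fun a ha => ?_, fun w hw => ?_, fun X hsX x hx => ?_⟩
  · by_cases hae : a = e
    · subst hae; rw [hhe]; exact hroot f hf
    · rw [hha a hae]; exact hroot a (mem_of_mem_erase ha)
  · have h1 := sum_erase_split he hf hef (fun a => if D.head a = w then 1 else 0)
      (fun a => if (D.split e f).head a = w then 1 else 0) (fun a ha => by rw [hha a ha])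
    have h2 := sum_erase_split he hf hef (fun a => if D.tail a = w then 1 else 0)
      (fun a => if (D.split e f).tail a = w then 1 else 0) (fun a ha => by rw [hta])
    have h3 := hpre w hw
    simp only [hhe, hta, hev] at h1 h2 ⊢
    omega
  · have h1 := sum_erase_split he hf hef
      (fun a => if D.head a ∈ X ∧ D.tail a ∉ X then 1 else 0)
      (fun a => if (D.split e f).head a ∈ X ∧ (D.split e f).tail a ∉ X then 1 else 0)
      (fun a ha => by rw [hha a ha, hta])
    have h2 := hdem X hsX x hx
    have h3 := hX X
    simp only [hhe, hta, hev] at h1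
    by_cases hrx : r x = 0
    · omega
    by_cases ht : D.cutIn A X ≤ r x
    · have h4 := h3 ⟨hsX, x, hx, Nat.pos_of_ne_zero hrx, ht⟩
      simp only [cutIn, hta] at h2 ⊢
      split_ifs at h1 <;> first | omega | grind
    · simp only [cutIn, hta] at h2 ht ⊢
      split_ifs at h1 <;> first | omega | grind

theorem PreflowOn.erase_loop [DecidableEq At] (h : D.PreflowOn A s) {f : At} (hf : f ∈ A)
    (hloop : D.head f = D.tail f) : D.PreflowOn (A.erase f) s := by
  intro w hw
  have h1 := h w hw
  rw [← add_sum_erase A _ hf, ← add_sum_erase A _ hf, hloop] at h1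
  omega

theorem Demand.erase_loop [DecidableEq At] (h : D.Demand A s r) {f : At} (hf : f ∈ A)
    (hloop : D.head f = D.tail f) : D.Demand (A.erase f) s r := by
  intro X hX x hx
  have h1 := h X hX x hx
  rw [cutIn, ← add_sum_erase A _ hf, hloop, if_neg (by tauto), zero_add] at h1
  exact h1

/-- Increase the number of members reaching `v` by one, when every vertex from which an arc
enters `v` has at least the demand of `v`. -/
theorem Packs.increment [DecidableEq At] [Fintype At] {v : Vt} (hroot : ∀ a ∈ A, D.head a ≠ s)
    (hdem : D.Demand A s r) (hvs : v ≠ s) (hv : 0 < r v)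
    (htail : ∀ a ∈ A, D.tail a ≠ s → r v ≤ r (D.tail a))
    {k : ℕ} (hk : r v ≤ k) {B : Fin k → Finset At}
    (h : D.Packs A s (Function.update r v (r v - 1)) B) :
    ∃ C : Fin k → Finset At, D.Packs A s r C := by
  classical
  obtain ⟨hA, hdis, hr⟩ := h
  choose C hCB _ hreach hhead huniq using
    fun i => exists_isArb_subset (D := D) (B := B i) (s := s) fun a ha => hroot a (hA i ha)
  have hCA : ∀ i, C i ⊆ A := fun i => (hCB i).trans (hA i)
  have hCdis : ∀ i j, i ≠ j → Disjoint (C i) (C j) :=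
    fun i j hij => disjoint_of_subset_left (hCB i) (disjoint_of_subset_right (hCB j) (hdis i j hij))
  let J : Vt → Finset (Fin k) := fun w => univ.filter fun i => D.ReachesOn (C i) s w
  have hJ : ∀ w, w ≠ s → w ≠ v → r w ≤ #(J w) := by
    intro w hw hwv
    obtain ⟨I, hI, hrI⟩ := hr w hw
    rw [Function.update_of_ne hwv] at hrI
    exact hrI.trans (card_le_card fun i hi => mem_filter.2 ⟨mem_univ i, hreach i _ (hI i hi)⟩)
  by_cases hJv : r v ≤ #(J v)
  · refine ⟨C, hCA, hCdis, fun w hw => ⟨J w, fun i hi => (mem_filter.1 hi).2, ?_⟩⟩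
    by_cases hwv : w = v
    · exact hwv ▸ hJv
    · exact hJ w hw hwv
  have hJv1 : r v - 1 ≤ #(J v) := by
    obtain ⟨I, hI, hrI⟩ := hr v hvs
    rw [Function.update_self] at hrI
    exact hrI.trans (card_le_card fun i hi => mem_filter.2 ⟨mem_univ i, hreach i _ (hI i hi)⟩)
  obtain ⟨g, hg, hgv, hgt, hgC⟩ :
      ∃ g ∈ A, D.head g = v ∧ D.tail g ≠ v ∧ ∀ i, g ∉ C i := by
    by_contra! hcon
    have h1 := hdem {v} (by simpa using hvs.symm) v (mem_singleton_self v)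
    have h2 : D.cutIn A {v} = #(A.filter fun a => D.head a = v ∧ D.tail a ≠ v) := by
      simp only [cutIn, card_filter, mem_singleton]
    have h3 : #(A.filter fun a => D.head a = v ∧ D.tail a ≠ v) ≤ #(J v) := by
      have hex : ∀ a ∈ A.filter (fun a => D.head a = v ∧ D.tail a ≠ v), ∃ i, a ∈ C i := by
        intro a ha
        rw [mem_filter] at ha
        exact hcon a ha.1 ha.2.1 ha.2.2
      have : Nonempty (Fin k) := ⟨⟨0, by omega⟩⟩
      choose! φ hφ using hex
      refine card_le_card_of_injOn φ (fun a ha => ?_) fun a ha b hb hab => ?_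
      · have h4 := hhead _ a (hφ a ha)
        rw [(mem_filter.1 ha).2.1] at h4
        exact mem_filter.2 ⟨mem_univ _, h4⟩
      · have h4 := hφ b hb
        rw [← hab] at h4
        exact huniq _ a (hφ a ha) b h4
          ((mem_filter.1 ha).2.1.trans (mem_filter.1 hb).2.1.symm)
    omega
  obtain ⟨i, hi, hiv⟩ : ∃ i, D.ReachesOn (C i) s (D.tail g) ∧ ¬ D.ReachesOn (C i) s v := by
    by_contra! hcon
    have h1 : J (D.tail g) ⊆ J v := fun i hi =>
      mem_filter.2 ⟨mem_univ i, hcon i (mem_filter.1 hi).2⟩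
    have h2 := card_le_card h1
    by_cases hgs : D.tail g = s
    · have h3 : J (D.tail g) = univ := by
        ext i
        simp only [J, hgs, mem_filter, mem_univ, true_and, iff_true]
        exact Relation.ReflTransGen.refl
      rw [h3, card_univ, Fintype.card_fin] at h2
      omega
    · have h3 := hJ _ hgs hgt
      have h4 := htail g hg hgs
      omega
  have hsub : ∀ j, C j ⊆ if j = i then insert g (C j) else C j := by
    intro j
    split_ifs
    · exact subset_insert g (C j)
    · exact Subset.rfl
  refine ⟨fun j => if j = i then insert g (C j) else C j, fun j => ?_, fun j l hjl => ?_,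
    fun w hw => ?_⟩
  · dsimp only
    split_ifs
    · exact insert_subset hg (hCA j)
    · exact hCA j
  · have h1 := disjoint_left.1 (hCdis j l hjl)
    rw [disjoint_left]
    intro a
    have h2 := hgC j
    have h3 := hgC l
    dsimp only
    split_ifs <;> grind
  · by_cases hwv : w = v
    · subst hwv
      refine ⟨insert i (J w), fun j hj => ?_, ?_⟩
      · rcases mem_insert.1 hj with rfl | hj
        · dsimp only
          rw [if_pos rfl, ← hgv]
          exact ReachesOn.snoc (mem_insert_self g _) (hi.mono (subset_insert g _))
        · exact (mem_filter.1 hj).2.mono (hsub j)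
      · have hiJ : i ∉ J w := fun h => hiv (mem_filter.1 h).2
        rw [card_insert_of_notMem hiJ]
        omega
    · exact ⟨J w, fun j hj => (mem_filter.1 hj).2.mono (hsub j), hJ w hw hwv⟩

/-- In a pre-flow digraph, demands bounded by the cuts can be packed. -/
theorem exists_packs [Fintype Vt] [DecidableEq At] [Fintype At] (D : Dgraph Vt At) (A : Finset At)
    (s : Vt) (r : Vt → ℕ) {k : ℕ} (hk : ∀ v, r v ≤ k) (hroot : ∀ a ∈ A, D.head a ≠ s)
    (hpre : D.PreflowOn A s) (hdem : D.Demand A s r) :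
    ∃ B : Fin k → Finset At, D.Packs A s r B := by
  induction hn : ∑ v, r v + #A using Nat.strong_induction_on generalizing D A r with
  | _ n ih =>
    by_cases hf : ∃ f ∈ A, D.tail f ≠ s ∧ r (D.tail f) = 0
    · obtain ⟨f, hf, hfs, hrf⟩ := hf
      have hcard := card_erase_lt_of_mem hf
      by_cases hloop : D.head f = D.tail f
      · obtain ⟨B, hB, h⟩ := ih _ (by omega) D (A.erase f) r hk
          (fun a ha => hroot a (mem_of_mem_erase ha)) (hpre.erase_loop hf hloop)
          (hdem.erase_loop hf hloop) rfl
        exact ⟨B, fun i => (hB i).trans (erase_subset f A), h⟩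
      · obtain ⟨e, -, hef, h1, h2, h3⟩ := exists_split hroot hpre hdem hf hloop hfs hrf
        obtain ⟨B, hB⟩ := ih _ (by omega) (D.split e f) (A.erase f) r hk h1 h2 h3 rfl
        exact hB.of_split hf hef
    · push Not at hf
      by_cases hv : ∃ v, v ≠ s ∧ 0 < r v
      · obtain ⟨v, hv, hmin⟩ := exists_min_image (univ.filter fun v => v ≠ s ∧ 0 < r v) r
          (by obtain ⟨v, hv⟩ := hv; exact ⟨v, by simpa using hv⟩)
        simp only [mem_filter, mem_univ, true_and] at hv hmin
        have hle : ∀ w, Function.update r v (r v - 1) w ≤ r w := by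
          intro w
          by_cases hw : w = v
          · subst hw; simp
          · simp [hw]
        have hlt : ∑ w, Function.update r v (r v - 1) w < ∑ w, r w :=
          sum_lt_sum (fun w _ => hle w) ⟨v, mem_univ v, by simp; omega⟩
        obtain ⟨B, hB⟩ := ih _ (by omega) D A (Function.update r v (r v - 1))
          (fun w => (hle w).trans (hk w)) hroot hpre
          (fun X hX x hx => (hle x).trans (hdem X hX x hx)) rfl
        exact hB.increment hroot hdem hv.1 hv.2
          (fun a ha has => hmin _ ⟨has, Nat.pos_of_ne_zero (hf a ha has)⟩) (hk v)
      · push Not at hv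
        exact ⟨fun _ => ∅, fun _ => empty_subset A, fun _ _ _ => disjoint_empty_left _,
          fun v hvs => ⟨∅, by simp, by simpa using hv v hvs⟩⟩

theorem WalkFrom.exists_mem_entering {X : Finset Vt} {v : Vt} (hv : v ∈ X) :
    ∀ {p : List At} {u : Vt}, u ∉ X → D.WalkFrom u p v →
      ∃ a ∈ p, D.head a ∈ X ∧ D.tail a ∉ X := by
  intro p
  induction p with
  | nil => rintro u hu rfl; exact absurd hv hu
  | cons a p ih =>
    rintro u hu ⟨rfl, hw⟩
    by_cases ha : D.head a ∈ X
    · exact ⟨a, List.mem_cons_self, ha, hu⟩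
    · obtain ⟨b, hb, h⟩ := ih ha hw
      exact ⟨b, List.mem_cons_of_mem _ hb, h⟩

theorem lambda_le_cutIn [Fintype At] {X : Finset Vt} {v : Vt} (hs : s ∉ X)
    (hv : v ∈ X) : D.lambda s v ≤ D.cutIn univ X := by
  have h0 : D.HasTPaths (fun _ => 0) s v 0 := ⟨fun i => i.elim0, fun i => i.elim0, fun i => i.elim0⟩
  refine csSup_le ⟨0, h0⟩ ?_
  rintro k ⟨P, hP, hdis⟩
  choose φ hφ hφX using fun i => (hP i).1.1.exists_mem_entering hv hs
  rw [cutIn, ← card_filter]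
  have h := card_le_card_of_injOn (s := univ) (t := univ.filter fun a => D.head a ∈ X ∧ D.tail a ∉ X)
    φ (fun i _ => by simpa using hφX i) fun i _ j _ hij => by
      by_contra hne
      exact hdis i j hne _ (hφ i) (hij ▸ hφ j)
  simpa using h

end Cuts

end Dgraph

/-- Bang-Jensen, Frank, Jackson: Let `D = (V ∪ {s}, A)` be a pre-flow
directed graph (no arc enters `s` and `d⁻_D(v) ≥ d⁺_D(v)` for all `v ∈ V`). Then there is
a packing of `s`-arborescences such that each vertex `v ∈ V` belongs to at least
`λ_D(s,v)` of them. -/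
theorem packing_preflow_digraph
    {Vt At : Type} [Fintype Vt] [DecidableEq Vt] [Fintype At] [DecidableEq At]
    (D : Dgraph Vt At) (s : Vt)
    (hroot : ∀ a : At, D.head a ≠ s)
    (hpre : ∀ v : Vt, v ≠ s → D.outdeg v ≤ D.indeg v) :
    ∃ (k : ℕ) (B : Fin k → Finset At),
      (∀ i, D.IsArb s (B i)) ∧
      (∀ i j, i ≠ j → Disjoint (B i) (B j)) ∧
      ∀ v : Vt, v ≠ s →
        D.lambda s v ≤
          (Finset.univ.filter (fun i => v ∈ D.vertsF s (B i))).card := by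
  classical
  obtain ⟨B, -, hdis, hB⟩ := D.exists_packs Finset.univ s (D.lambda s)
    (k := ∑ v, D.lambda s v) (fun v => Finset.single_le_sum (fun _ _ => Nat.zero_le _)
      (Finset.mem_univ v)) (fun a _ => hroot a)
    (fun v hv => by
      simpa only [Dgraph.outdeg, Dgraph.indeg, Dgraph.indegOn, Finset.card_filter] using hpre v hv)
    (fun X hX x hx => Dgraph.lambda_le_cutIn hX hx)
  choose C hCB harb hreach _ _ using fun i =>
    Dgraph.exists_isArb_subset (D := D) (B := B i) (s := s) fun a _ => hroot a
  refine ⟨_, C, harb, fun i j hij => Finset.disjoint_of_subset_left (hCB i)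
    (Finset.disjoint_of_subset_right (hCB j) (hdis i j hij)), fun v hv => ?_⟩
  obtain ⟨I, hI, hr⟩ := hB v hv
  exact hr.trans (Finset.card_le_card fun i hi => Finset.mem_filter.2
    ⟨Finset.mem_univ i, Dgraph.mem_vertsF_of_reachesOn (hreach i v (hI i hi))⟩)
end

section
/- Let N = ((V ∪ {s}, A), τ) be a temporal network such that λ_N(s,v) ≥ 1 for every v ∈ V (i.e., N is time-respecting root-connected). Then N contains a spanning τ-respecting s-arborescence. -/
namespace Dgraph

/-- `D.ArrivesAt τ s k v` : some τ-respecting walk from `s` to `v` has arrival time (the label of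
its last arc, or `0` if there is none) and length given by the two components of `k`. -/
inductive ArrivesAt {Vt At : Type} (D : Dgraph Vt At) (τ : At → ℕ) (s : Vt) :
    ℕ ×ₗ ℕ → Vt → Prop
  | root : ArrivesAt D τ s (toLex (0, 0)) s
  | step {t n : ℕ} (a : At) : ArrivesAt D τ s (toLex (t, n)) (D.tail a) → t ≤ τ a →
      ArrivesAt D τ s (toLex (τ a, n + 1)) (D.head a)

variable {Vt At : Type} {D : Dgraph Vt At} {τ : At → ℕ} {s : Vt}

theorem ArrivesAt.extend_walk {p : List At} {t n : ℕ} {u v : Vt}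
    (hu : D.ArrivesAt τ s (toLex (t, n)) u) (hp : D.WalkFrom u p v)
    (hτ : List.IsChain (· ≤ ·) (t :: p.map τ)) : ∃ k, D.ArrivesAt τ s k v := by
  induction p generalizing t n u with
  | nil => exact ⟨_, (show u = v from hp) ▸ hu⟩
  | cons a p ih =>
    obtain ⟨rfl, hp⟩ := hp
    rw [List.map_cons, List.isChain_cons_cons] at hτ
    exact ih (.step a hu hτ.1) hp hτ.2

theorem exists_arrivesAt_of_respects {p : List At} {v : Vt} (hp : D.WalkFrom s p v)
    (hτ : Respects τ p) : ∃ k, D.ArrivesAt τ s k v := by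
  refine ArrivesAt.root.extend_walk hp ?_
  unfold Respects at hτ
  cases p with
  | nil => simp
  | cons a p => exact List.isChain_cons_cons.2 ⟨Nat.zero_le _, hτ⟩

theorem exists_path_of_one_le_lambdaT {v : Vt} (h : 1 ≤ D.lambdaT τ s v) :
    ∃ p, D.IsPath s p v ∧ Respects τ p := by
  have hmem : D.lambdaT τ s v ∈ {k | D.HasTPaths τ s v k} := by
    refine Nat.sSup_mem ?_ ?_ <;> by_contra hS
    · rw [lambdaT, Set.not_nonempty_iff_eq_empty.1 hS, Nat.sSup_def ⟨0, by simp⟩] at h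
      simp at h
    · rw [lambdaT, csSup_of_not_bddAbove hS] at h
      simp at h
  obtain ⟨P, hP, -⟩ := hmem
  exact ⟨P ⟨0, h⟩, hP _⟩

/-- A vertex other than the root is entered by the last arc of an earliest-arrival walk; the
best arrival at the tail of that arc is strictly better, and not later than the arc. -/
theorem ArrivesAt.exists_last_arc {key : Vt → ℕ ×ₗ ℕ}
    (hmin : ∀ v k, D.ArrivesAt τ s k v → key v ≤ k) {v : Vt} (hv : v ≠ s)
    (h : D.ArrivesAt τ s (key v) v) :
    ∃ a, D.head a = v ∧ τ a = (ofLex (key v)).1 ∧ key (D.tail a) < key v ∧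
      (ofLex (key (D.tail a))).1 ≤ τ a := by
  generalize hk : key v = k at h
  cases h with
  | root => exact absurd rfl hv
  | @step t n a hu ht =>
    have hle := hmin _ _ hu
    refine ⟨a, rfl, rfl, hle.trans_lt ?_, ?_⟩
    · rw [Prod.Lex.toLex_lt_toLex]
      dsimp only
      omega
    · rw [Prod.Lex.le_iff] at hle
      simp only [ofLex_toLex] at hle
      omega

theorem WalkFrom.le_and_lt_of_ne_nil {α : Type*} [Preorder α] {f : Vt → α} {B : Set At}
    (hf : ∀ a ∈ B, f (D.tail a) < f (D.head a)) {p : List At} {u v : Vt}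
    (hp : D.WalkFrom u p v) (hB : ∀ a ∈ p, a ∈ B) :
    f u ≤ f v ∧ (p ≠ [] → f u < f v) := by
  induction p generalizing u with
  | nil => exact ⟨(congrArg f (show u = v from hp)).le, fun h => absurd rfl h⟩
  | cons a p ih =>
    obtain ⟨rfl, hp⟩ := hp
    rw [List.forall_mem_cons] at hB
    have hlt := (hf a hB.1).trans_le (ih hp hB.2).1
    exact ⟨hlt.le, fun _ => hlt⟩

theorem acyclicOn_of_lt {α : Type*} [Preorder α] {f : Vt → α} {B : Set At}
    (hf : ∀ a ∈ B, f (D.tail a) < f (D.head a)) : D.AcyclicOn B := by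
  rintro ⟨v, p, hne, hB, hp⟩
  exact lt_irrefl _ ((hp.le_and_lt_of_ne_nil hf hB).2 hne)

theorem WalkFrom.respects {B : Set At}
    (hB : ∀ a ∈ B, ∀ b ∈ B, D.head a = D.tail b → τ a ≤ τ b) {p : List At} {u v : Vt}
    (hp : D.WalkFrom u p v) (hpB : ∀ a ∈ p, a ∈ B) : Respects τ p := by
  unfold Respects
  induction p generalizing u with
  | nil => exact List.isChain_nil
  | cons a p ih =>
    obtain ⟨-, hp⟩ := hp
    rw [List.forall_mem_cons] at hpB
    have hchain := ih hp hpB.2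
    cases p with
    | nil => exact List.isChain_singleton _
    | cons b p =>
      exact List.isChain_cons_cons.2
        ⟨hB a hpB.1 b (hpB.2 b List.mem_cons_self) hp.1.symm, hchain⟩

end Dgraph


/-- Every time-respecting root-connected temporal network
`N = ((V ∪ {s}, A), τ)` (i.e. `λ_N(s,v) ≥ 1` for every `v ∈ V`) contains a spanning
τ-respecting `s`-arborescence. -/
theorem spanning_tarb_of_rootConnected
    {Vt At : Type} [Fintype Vt] [DecidableEq Vt] [Fintype At] [DecidableEq At]
    (D : Dgraph Vt At) (τ : At → ℕ) (s : Vt)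
    (hroot : ∀ a : At, D.head a ≠ s)
    (hconn : ∀ v : Vt, v ≠ s → 1 ≤ D.lambdaT τ s v) :
    ∃ B : Finset At, D.IsTArb τ s B ∧ D.vertsF s B = Finset.univ := by
  have hreach (v : Vt) : ∃ k, D.ArrivesAt τ s k v := by
    by_cases hv : v = s
    · subst hv
      exact ⟨_, .root⟩
    · obtain ⟨p, hp, hτ⟩ := Dgraph.exists_path_of_one_le_lambdaT (hconn v hv)
      exact Dgraph.exists_arrivesAt_of_respects hp.1 hτ
  have hbest (v : Vt) : ∃ k, D.ArrivesAt τ s k v ∧ ∀ k', D.ArrivesAt τ s k' v → k ≤ k' :=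
    have ⟨k, hk, hmin⟩ := exists_minimal_of_wellFoundedLT (D.ArrivesAt τ s · v) (hreach v)
    ⟨k, hk, fun k' hk' => (le_total k k').elim id (hmin hk')⟩
  choose key hkey hmin using hbest
  choose par hhead hτ hlt hle using
    fun (v : Vt) (hv : v ≠ s) => (hkey v).exists_last_arc hmin hv
  let B : Finset At := Finset.univ.filter fun a => par (D.head a) (hroot a) = a
  have hB {a : At} : a ∈ B ↔ par (D.head a) (hroot a) = a := by simp [B]
  have hpar (v : Vt) (hv : v ≠ s) : par v hv ∈ B := by
    rw [hB]
    congr 1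
    exact hhead v hv
  refine ⟨B, ⟨⟨Dgraph.acyclicOn_of_lt (f := key) fun a ha => ?_, fun v _ hv => ?_⟩,
    fun v _ p hpB hp => hp.1.respects (B := ↑B) (fun a ha b hb hab => ?_) hpB⟩, ?_⟩
  · have := hlt _ (hroot a)
    rwa [hB.1 ha] at this
  · refine Finset.card_eq_one.2 ⟨par v hv, Finset.ext fun a => ?_⟩
    rw [Finset.mem_filter, Finset.mem_singleton]
    constructor
    · rintro ⟨ha, rfl⟩
      exact (hB.1 ha).symm
    · rintro rfl
      exact ⟨hpar v hv, hhead v hv⟩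
  · have ha' := hτ _ (hroot a)
    have hb' := hle _ (hroot b)
    rw [hB.1 ha] at ha'
    rw [hB.1 hb, ← hab, ← ha'] at hb'
    exact hb'
  · refine Finset.eq_univ_of_forall fun v => ?_
    by_cases hv : v = s
    · exact Finset.mem_insert.2 (.inl hv)
    · exact Finset.mem_insert_of_mem <| Finset.mem_union_right _ <|
        Finset.mem_image.2 ⟨_, hpar v hv, hhead v hv⟩
end

section
/- For every positive integer k, there exists a temporal network N = ((V ∪ {s}, A), τ) such that λ_N(s,v) ≥ k for all v ∈ V, and yet N contains no packing of 2 spanning τ-respecting s-arborescences. -/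
namespace Dgraph

variable {Vt At : Type}

theorem isPath_singleton {D : Dgraph Vt At} {a : At} (h : D.tail a ≠ D.head a) :
    D.IsPath (D.tail a) [a] (D.head a) := by
  simp [IsPath, WalkFrom, walkVerts, h]

theorem isPath_pair {D : Dgraph Vt At} {a b : At} (hab : D.head a = D.tail b)
    (h₁ : D.tail a ≠ D.head a) (h₂ : D.tail a ≠ D.head b) (h₃ : D.tail b ≠ D.head b) :
    D.IsPath (D.tail a) [a, b] (D.head b) := by
  simp [IsPath, WalkFrom, walkVerts, h₂, h₃, hab]
  simpa [hab] using h₁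

theorem respects_singleton {τ : At → ℕ} {a : At} : Respects τ [a] :=
  List.isChain_singleton _

theorem respects_pair {τ : At → ℕ} {a b : At} : Respects τ [a, b] ↔ τ a ≤ τ b :=
  List.isChain_pair

theorem HasTPaths.le_card [Fintype At] {D : Dgraph Vt At} {τ : At → ℕ} {s v : Vt} {k : ℕ} (hv : v ≠ s)
    (h : D.HasTPaths τ s v k) : k ≤ Fintype.card At := by
  obtain ⟨P, hP, hdisj⟩ := h
  have hne (i : Fin k) : P i ≠ [] := by
    intro hi
    have := (hP i).1.1
    rw [hi] at this
    exact hv this.symm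
  have hinj : Function.Injective fun i => (P i).head (hne i) := by
    intro i j hij
    by_contra hne'
    refine hdisj i j hne' _ (List.head_mem (hne i)) ?_
    simp only at hij
    rw [hij]
    exact List.head_mem (hne j)
  simpa using Fintype.card_le_of_injective _ hinj

theorem HasTPaths.le_lambdaT [Fintype At] {D : Dgraph Vt At} {τ : At → ℕ} {s v : Vt} {k : ℕ} (hv : v ≠ s)
    (h : D.HasTPaths τ s v k) : k ≤ D.lambdaT τ s v :=
  le_csSup ⟨Fintype.card At, fun _ hl => HasTPaths.le_card hv hl⟩ h

theorem IsTArb.exists_mem_head_eq [DecidableEq Vt] {D : Dgraph Vt At} {τ : At → ℕ} {s v : Vt} {B : Finset At}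
    (hB : D.IsTArb τ s B) (hmem : v ∈ D.vertsF s B) (hv : v ≠ s) :
    ∃ a ∈ B, D.head a = v := by
  have h := hB.1.2 v hmem hv
  obtain ⟨a, ha⟩ := Finset.card_pos.1 (h.symm ▸ Nat.one_pos : 0 < D.indegOn B v)
  exact ⟨a, (Finset.mem_filter.1 ha).1, (Finset.mem_filter.1 ha).2⟩

/-- Relabel the vertices and arcs of a directed graph. -/
def relabel {Vt' At' : Type} (D : Dgraph Vt At) (eV : Vt ≃ Vt') (eA : At ≃ At') :
    Dgraph Vt' At' where
  tail a := eV (D.tail (eA.symm a))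
  head a := eV (D.head (eA.symm a))

/-- The root `none` is joined by `k` parallel arcs to each of the middle vertices in `I`, and
each embedding `f : Fin k ↪ I` is a vertex entered by one arc from each `f i`. -/
def embeddingGraph (I : Type) (k : ℕ) :
    Dgraph (Option (I ⊕ (Fin k ↪ I))) ((I × Fin k) ⊕ ((Fin k ↪ I) × Fin k)) where
  tail := Sum.elim (fun _ => none) fun b => some (.inl (b.1 b.2))
  head := Sum.elim (fun a => some (.inl a.1)) fun b => some (.inr b.1)

/-- The `j`-th parallel arc from the root to a middle vertex has time `j`; all other arcs have
time `0`, so they can only be used after the `0`-th parallel arc. -/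
def embeddingTime (I : Type) (k : ℕ) : (I × Fin k) ⊕ ((Fin k ↪ I) × Fin k) → ℕ :=
  Sum.elim (fun a => a.2) fun _ => 0

section Embedding

variable {I V A : Type} {k : ℕ}
  (eV : Option (I ⊕ (Fin k ↪ I)) ≃ V) (eA : (I × Fin k) ⊕ ((Fin k ↪ I) × Fin k) ≃ A)

theorem hasTPaths_embeddingGraph (hk : 0 < k) (x : I ⊕ (Fin k ↪ I)) :
    ((embeddingGraph I k).relabel eV eA).HasTPaths (embeddingTime I k ∘ eA.symm) (eV none)
      (eV (some x)) k := by
  rcases x with i | f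
  · refine ⟨fun j => [eA (.inl (i, j))], fun j => ⟨?_, respects_singleton⟩, ?_⟩
    · simpa [relabel, embeddingGraph] using
        isPath_singleton (D := (embeddingGraph I k).relabel eV eA) (a := eA (.inl (i, j)))
          (by simp [relabel, embeddingGraph])
    · simp
  · refine ⟨fun j => [eA (.inl (f j, ⟨0, hk⟩)), eA (.inr (f, j))], fun j => ⟨?_, ?_⟩, ?_⟩
    · simpa [relabel, embeddingGraph] using
        isPath_pair (D := (embeddingGraph I k).relabel eV eA)
          (a := eA (.inl (f j, ⟨0, hk⟩))) (b := eA (.inr (f, j)))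
          (by simp [relabel, embeddingGraph]) (by simp [relabel, embeddingGraph])
          (by simp [relabel, embeddingGraph]) (by simp [relabel, embeddingGraph])
    · simp [respects_pair, embeddingTime]
    · intro i j hij a ha
      simp only [List.mem_cons, List.not_mem_nil, or_false] at ha ⊢
      rcases ha with rfl | rfl <;> simp [hij]

/-- Each embedding vertex forces a time `0` arc at one of its neighbours into every spanning
time-respecting arborescence. -/
theorem exists_early_arc_mem [DecidableEq V] (hk : 0 < k) {B : Finset A}
    (hB : ((embeddingGraph I k).relabel eV eA).IsTArb (embeddingTime I k ∘ eA.symm) (eV none) B)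
    (hspan : ∀ v, v ∈ ((embeddingGraph I k).relabel eV eA).vertsF (eV none) B)
    (f : Fin k ↪ I) : ∃ i, eA (.inl (f i, ⟨0, hk⟩)) ∈ B := by
  obtain ⟨b, hbB, hb⟩ := hB.exists_mem_head_eq (hspan (eV (some (.inr f)))) (by simp)
  obtain ⟨b, rfl⟩ := eA.surjective b
  rcases b with b | ⟨g, i⟩
  · simp [relabel, embeddingGraph] at hb
  obtain rfl : g = f := by simpa [relabel, embeddingGraph] using hb
  obtain ⟨a, haB, ha⟩ := hB.exists_mem_head_eq (hspan (eV (some (.inl (g i))))) (by simp)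
  obtain ⟨a, rfl⟩ := eA.surjective a
  rcases a with ⟨x, j⟩ | a
  swap
  · simp [relabel, embeddingGraph] at ha
  obtain rfl : x = g i := by simpa [relabel, embeddingGraph] using ha
  have hpath := isPath_pair (D := (embeddingGraph I k).relabel eV eA)
    (a := eA (.inl (g i, j))) (b := eA (.inr (g, i)))
    (by simp [relabel, embeddingGraph]) (by simp [relabel, embeddingGraph])
    (by simp [relabel, embeddingGraph]) (by simp [relabel, embeddingGraph])
  have hres := hB.2 _ (hspan _) [eA (.inl (g i, j)), eA (.inr (g, i))] (by simp [haB, hbB])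
    (by simpa [relabel, embeddingGraph] using hpath)
  have hj : j = ⟨0, hk⟩ := by
    simpa [respects_pair, embeddingTime, Fin.ext_iff] using hres
  exact ⟨i, hj ▸ haB⟩

end Embedding

end Dgraph

/-- Every two-colouring of `2 * k` points has a monochromatic set of `k` points. -/
theorem exists_monochromatic_embedding (k : ℕ) (P : Fin (2 * k) → Prop) :
    ∃ f : Fin k ↪ Fin (2 * k), (∀ i, P (f i)) ∨ ∀ i, ¬ P (f i) := by
  classical
  have key (Q : Fin (2 * k) → Prop) (hQ : k ≤ Fintype.card {i // Q i}) :
      ∃ f : Fin k ↪ Fin (2 * k), ∀ i, Q (f i) := by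
    obtain ⟨g⟩ := Function.Embedding.nonempty_of_card_le (α := Fin k) (β := {i // Q i})
      (by simpa using hQ)
    exact ⟨g.trans (Function.Embedding.subtype _), fun i => (g i).2⟩
  by_cases h : k ≤ Fintype.card {i // P i}
  · obtain ⟨f, hf⟩ := key P h
    exact ⟨f, .inl hf⟩
  · obtain ⟨f, hf⟩ := key (fun i => ¬ P i) (by
      rw [Fintype.card_subtype_compl, Fintype.card_fin]; omega)
    exact ⟨f, .inr hf⟩

open Dgraph in
/-- For every positive integer `k` there exists a temporal network
`N = ((V ∪ {s}, A), τ)` with `λ_N(s,v) ≥ k` for all `v ∈ V` which contains no packing of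
`2` spanning τ-respecting `s`-arborescences. -/
theorem exists_highly_connected_no_two_spanning (k : ℕ) (hk : 0 < k) :
    ∃ (n m : ℕ) (D : Dgraph (Fin n) (Fin m)) (τ : Fin m → ℕ) (s : Fin n),
      (∀ a : Fin m, D.head a ≠ s) ∧
      (∀ v : Fin n, v ≠ s → k ≤ D.lambdaT τ s v) ∧
      ¬ ∃ B₁ B₂ : Finset (Fin m), Disjoint B₁ B₂ ∧
          D.IsTArb τ s B₁ ∧ D.vertsF s B₁ = Finset.univ ∧
          D.IsTArb τ s B₂ ∧ D.vertsF s B₂ = Finset.univ := by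
  let eV := Fintype.equivFin (Option (Fin (2 * k) ⊕ (Fin k ↪ Fin (2 * k))))
  let eA := Fintype.equivFin ((Fin (2 * k) × Fin k) ⊕ ((Fin k ↪ Fin (2 * k)) × Fin k))
  refine ⟨_, _, (embeddingGraph _ k).relabel eV eA, embeddingTime _ k ∘ eA.symm, eV none,
    ?_, ?_, ?_⟩
  · intro a
    obtain ⟨a, rfl⟩ := eA.surjective a
    rcases a with a | a <;> simp [relabel, embeddingGraph]
  · intro v hv
    obtain ⟨x, rfl⟩ := eV.surjective v
    rcases x with _ | x
    · exact absurd rfl hv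
    · exact (hasTPaths_embeddingGraph eV eA hk x).le_lambdaT hv
  · rintro ⟨B₁, B₂, hdisj, h₁, hs₁, h₂, hs₂⟩
    obtain ⟨f, hf | hf⟩ := exists_monochromatic_embedding k
      fun i => eA (.inl (i, ⟨0, hk⟩)) ∈ B₁
    · obtain ⟨i, hi⟩ := exists_early_arc_mem eV eA hk h₂ (by simp [hs₂]) f
      exact Finset.disjoint_left.1 hdisj (hf i) hi
    · obtain ⟨i, hi⟩ := exists_early_arc_mem eV eA hk h₁ (by simp [hs₁]) f
      exact hf i hi
end

section
/- Every k-uniform hypergraph that admits no proper 2-coloring has at least 2^{k−1} hyperedges. -/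
/-- A set `H` is contained in exactly `2 ^ (|V| - |H|)` subsets of `V`. -/
lemma card_Icc_univ_finset {V : Type*} [Fintype V] [DecidableEq V] (H : Finset V) :
    (Finset.Icc H Finset.univ).card = 2 ^ (Fintype.card V - H.card) := by
  rw [Finset.card_Icc_finset (Finset.subset_univ H), Finset.card_univ]

/-- There are exactly `2 ^ (|V| - |H|)` subsets of `V` disjoint from `H`. -/
lemma card_powerset_compl {V : Type*} [Fintype V] [DecidableEq V] (H : Finset V) :
    Hᶜ.powerset.card = 2 ^ (Fintype.card V - H.card) := by
  rw [Finset.card_powerset, Finset.card_compl]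

/-- Without a proper 2-coloring, every vertex set contains or avoids some hyperedge. -/
lemma exists_subset_or_subset_compl {V : Type*} [Fintype V] [DecidableEq V]
    {E : Finset (Finset V)}
    (hnocol : ¬ ∃ c : V → Bool, ∀ H ∈ E, ∃ u ∈ H, ∃ w ∈ H, c u ≠ c w) (S : Finset V) :
    ∃ H ∈ E, H ⊆ S ∨ S ⊆ Hᶜ := by
  by_contra! h
  refine hnocol ⟨fun v => decide (v ∈ S), fun H hH => ?_⟩
  obtain ⟨hsub, hdisj⟩ := h H hH
  obtain ⟨u, huH, huS⟩ := Finset.not_subset.mp hsub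
  obtain ⟨w, hwS, hwH⟩ := Finset.not_subset.mp hdisj
  exact ⟨u, huH, w, by simpa using hwH, by simp [huS, hwS]⟩

/-- Erdős: Every `k`-uniform hypergraph admitting no proper 2-coloring has
at least `2^(k-1)` hyperedges. -/
theorem erdos_hypergraph_two_coloring
    {V : Type} [Fintype V] [DecidableEq V] (k : ℕ) (E : Finset (Finset V))
    (hunif : ∀ H ∈ E, H.card = k)
    (hnocol : ¬ ∃ c : V → Bool, ∀ H ∈ E, ∃ u ∈ H, ∃ w ∈ H, c u ≠ c w) :
    2 ^ (k - 1) ≤ E.card := by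
  obtain ⟨H₀, hH₀, -⟩ := exists_subset_or_subset_compl hnocol ∅
  have hE : 0 < E.card := Finset.card_pos.mpr ⟨H₀, hH₀⟩
  have hkV : k ≤ Fintype.card V := hunif H₀ hH₀ ▸ Finset.card_le_univ H₀
  rcases Nat.eq_zero_or_pos k with rfl | hk
  · simpa using hE
  have hcover : (Finset.univ : Finset (Finset V)) ⊆
      E.biUnion fun H => Finset.Icc H Finset.univ ∪ Hᶜ.powerset := by
    intro S _
    obtain ⟨H, hH, h⟩ := exists_subset_or_subset_compl hnocol S
    exact Finset.mem_biUnion.mpr ⟨H, hH, by simpa using h⟩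
  have hcount : 2 ^ Fintype.card V ≤ E.card * (2 * 2 ^ (Fintype.card V - k)) := by
    rw [← Fintype.card_finset, ← Finset.card_univ]
    refine (Finset.card_le_card hcover).trans
      (Finset.card_biUnion_le_card_mul _ _ _ fun H hH => ?_)
    refine (Finset.card_union_le _ _).trans_eq ?_
    rw [card_Icc_univ_finset, card_powerset_compl, hunif H hH, two_mul]
  have hpow : 2 ^ Fintype.card V = 2 ^ (k - 1) * (2 * 2 ^ (Fintype.card V - k)) := by
    rw [← pow_succ', ← pow_add]
    congr 1
    omega
  exact Nat.le_of_mul_le_mul_right (hpow ▸ hcount) (by positivity)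
end

section
/- Let H_k = (V_k, E_k) be a k-uniform hypergraph that admits no proper 2-coloring, and let D_k be the directed graph with vertex set V_k ∪ U_k ∪ {s}, where U_k has one vertex u_H for each hyperedge H ∈ E_k, and with arcs: an arc s→v for every v ∈ V_k, and an arc v→u_H for every v ∈ V_k and H ∈ E_k with v ∈ H. Then λ_{D_k}(s,u) = k for every u ∈ U_k, and D_k contains no packing of two (s, U_k)-arborescences. -/
/-- The directed graph `D_k` built from a hypergraph `(Vk, E)`: vertices are `s` (`none`),
the hypergraph vertices (`some (Sum.inl v)`) and one vertex `u_H` per hyperedge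
(`some (Sum.inr H)`); arcs are `s → v` for every `v ∈ Vk` and `v → u_H` whenever `v ∈ H`. -/
def steinerD {Vk : Type} [DecidableEq Vk] (E : Finset (Finset Vk)) :
    Dgraph (Option (Vk ⊕ {H : Finset Vk // H ∈ E}))
      (Vk ⊕ {p : Vk × {H : Finset Vk // H ∈ E} // p.1 ∈ p.2.1}) where
  tail a :=
    match a with
    | Sum.inl _ => none
    | Sum.inr p => some (Sum.inl p.1.1)
  head a :=
    match a with
    | Sum.inl v => some (Sum.inl v)
    | Sum.inr p => some (Sum.inr p.1.2)

namespace Dgraph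

variable {Vt At : Type}

/-- A walk between distinct vertices contains an arc entering its endpoint. -/
theorem WalkFrom.exists_head_eq {D : Dgraph Vt At} {v : Vt} :
    ∀ {u : Vt} {p : List At}, D.WalkFrom u p v → u ≠ v → ∃ a ∈ p, D.head a = v
  | _, [], h, hne => absurd h hne
  | _, a :: p, h, _ => by
    by_cases ha : D.head a = v
    · exact ⟨a, by simp, ha⟩
    · obtain ⟨b, hb, hbv⟩ := WalkFrom.exists_head_eq h.2 ha
      exact ⟨b, by simp [hb], hbv⟩

/-- The number of arc-disjoint paths to `v` is at most the in-degree of `v`. -/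
theorem HasTPaths.le_indeg [DecidableEq Vt] [Fintype At] {D : Dgraph Vt At} {τ : At → ℕ}
    {s v : Vt} {n : ℕ} (h : D.HasTPaths τ s v n) (hne : s ≠ v) : n ≤ D.indeg v := by
  obtain ⟨P, hP, hdisj⟩ := h
  choose a haP hav using fun i => WalkFrom.exists_head_eq (hP i).1.1 hne
  have hinj : Function.Injective a := fun i j hij => by
    by_contra hne'
    exact hdisj i j hne' (a i) (haP i) (hij ▸ haP j)
  simpa [indeg, indegOn] using Finset.card_le_card_of_injOn (s := Finset.univ)
    (t := Finset.univ.filter fun b => D.head b = v) a (fun i _ => by simp [hav i]) hinj.injOn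

/-- Every vertex of an arborescence other than the root is entered by one of its arcs. -/
theorem IsArb.exists_head_eq [DecidableEq Vt] {D : Dgraph Vt At} {s v : Vt}
    {B : Finset At} (hB : D.IsArb s B) (hv : v ∈ D.vertsF s B) (hne : v ≠ s) :
    ∃ a ∈ B, D.head a = v := by
  obtain ⟨a, ha⟩ := Finset.card_pos.mp (by
    have := hB.2 v hv hne
    unfold indegOn at this
    omega : 0 < (B.filter fun a => D.head a = v).card)
  exact ⟨a, (Finset.mem_filter.mp ha).1, (Finset.mem_filter.mp ha).2⟩

theorem tail_mem_vertsF [DecidableEq Vt] (D : Dgraph Vt At) (s : Vt) {B : Finset At}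
    {a : At} (ha : a ∈ B) : D.tail a ∈ D.vertsF s B :=
  Finset.mem_insert_of_mem (Finset.mem_union_left _ (Finset.mem_image_of_mem _ ha))

end Dgraph

section SteinerD

variable {Vk : Type} [DecidableEq Vk] {E : Finset (Finset Vk)}

theorem steinerD_head_eq_inl {v : Vk}
    {a : Vk ⊕ {p : Vk × {H : Finset Vk // H ∈ E} // p.1 ∈ p.2.1}}
    (h : (steinerD E).head a = some (Sum.inl v)) : a = Sum.inl v := by
  rcases a with w | p <;> simp_all [steinerD]

theorem steinerD_head_eq_inr {u : {H : Finset Vk // H ∈ E}}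
    {a : Vk ⊕ {p : Vk × {H : Finset Vk // H ∈ E} // p.1 ∈ p.2.1}}
    (h : (steinerD E).head a = some (Sum.inr u)) :
    ∃ (v : Vk) (hv : v ∈ u.1), a = Sum.inr ⟨(v, u), hv⟩ := by
  rcases a with w | ⟨⟨v, u'⟩, hv⟩
  · simp [steinerD] at h
  · obtain rfl : u' = u := by simpa [steinerD] using h
    exact ⟨v, hv, rfl⟩

theorem steinerD_indeg_inr [Fintype Vk] (u : {H : Finset Vk // H ∈ E}) :
    (steinerD E).indeg (some (Sum.inr u)) = u.1.card := by
  symm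
  refine Finset.card_bij (fun v hv => Sum.inr ⟨(v, u), hv⟩) ?_ ?_ ?_
  · exact fun v hv => Finset.mem_filter.mpr ⟨Finset.mem_univ _, rfl⟩
  · intro v _ w _ h
    simpa using h
  · intro a ha
    obtain ⟨v, hv, rfl⟩ := steinerD_head_eq_inr (Finset.mem_filter.mp ha).2
    exact ⟨v, hv, rfl⟩

theorem steinerD_hasTPaths [Fintype Vk] (u : {H : Finset Vk // H ∈ E}) :
    (steinerD E).HasTPaths (fun _ => 0) none (some (Sum.inr u)) u.1.card := by
  let e := u.1.equivFin.symm
  refine ⟨fun i => [Sum.inl (e i).1, Sum.inr ⟨((e i).1, u), (e i).2⟩], fun i => ⟨⟨?_, ?_⟩, ?_⟩, ?_⟩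
  · simp [Dgraph.WalkFrom, steinerD]
  · simp [Dgraph.walkVerts, steinerD]
  · exact List.isChain_pair.mpr le_rfl
  · intro i j hij a hai haj
    have hne : (e i).1 ≠ (e j).1 := fun h => hij (e.injective (Subtype.ext h))
    simp only [List.mem_cons, List.not_mem_nil, or_false] at hai haj
    rcases hai with rfl | rfl <;> simp [hne] at haj

theorem steinerD_lambda [Fintype Vk] (u : {H : Finset Vk // H ∈ E}) :
    (steinerD E).lambda none (some (Sum.inr u)) = u.1.card :=
  IsGreatest.csSup_eq ⟨steinerD_hasTPaths u, fun _ hn =>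
    (hn.le_indeg (by simp)).trans_eq (steinerD_indeg_inr u)⟩

/-- An arborescence of `D_k` spanning `u_H` uses an arc from the root to some `v ∈ H`. -/
theorem steinerD_exists_root_arc
    {B : Finset (Vk ⊕ {p : Vk × {H : Finset Vk // H ∈ E} // p.1 ∈ p.2.1})}
    (hB : (steinerD E).IsArb none B) (u : {H : Finset Vk // H ∈ E})
    (hu : some (Sum.inr u) ∈ (steinerD E).vertsF none B) :
    ∃ v ∈ u.1, Sum.inl v ∈ B := by
  obtain ⟨a, ha, hau⟩ := hB.exists_head_eq hu (by simp)
  obtain ⟨v, hv, rfl⟩ := steinerD_head_eq_inr hau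
  have hmem : some (Sum.inl v) ∈ (steinerD E).vertsF none B :=
    (steinerD E).tail_mem_vertsF none ha
  obtain ⟨b, hb, hbv⟩ := hB.exists_head_eq hmem (by simp)
  exact ⟨v, hv, steinerD_head_eq_inl hbv ▸ hb⟩

end SteinerD

/-- If `H_k = (V_k, E_k)` is a `k`-uniform hypergraph with no proper
2-coloring, then in the directed graph `D_k` we have `λ_{D_k}(s, u) = k` for every
`u ∈ U_k`, and `D_k` has no packing of two `(s, U_k)`-arborescences. -/
theorem steinerD_no_two_steiner_arborescences
    {Vk : Type} [Fintype Vk] [DecidableEq Vk] (k : ℕ) (E : Finset (Finset Vk))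
    (hunif : ∀ H ∈ E, H.card = k)
    (hnocol : ¬ ∃ c : Vk → Bool, ∀ H ∈ E, ∃ u ∈ H, ∃ w ∈ H, c u ≠ c w) :
    (∀ u : {H : Finset Vk // H ∈ E},
        (steinerD E).lambda none (some (Sum.inr u)) = k) ∧
    ¬ ∃ B₁ B₂ : Finset (Vk ⊕ {p : Vk × {H : Finset Vk // H ∈ E} // p.1 ∈ p.2.1}),
        Disjoint B₁ B₂ ∧
        (steinerD E).IsArb none B₁ ∧
        (∀ u : {H : Finset Vk // H ∈ E}, some (Sum.inr u) ∈ (steinerD E).vertsF none B₁) ∧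
        (steinerD E).IsArb none B₂ ∧
        (∀ u : {H : Finset Vk // H ∈ E}, some (Sum.inr u) ∈ (steinerD E).vertsF none B₂) := by
  refine ⟨fun u => (steinerD_lambda u).trans (hunif u.1 u.2), ?_⟩
  rintro ⟨B₁, B₂, hdisj, hB₁, hU₁, hB₂, hU₂⟩
  refine hnocol ⟨fun v => decide (Sum.inl v ∈ B₁), fun H hH => ?_⟩
  obtain ⟨v, hv, hvB⟩ := steinerD_exists_root_arc hB₁ ⟨H, hH⟩ (hU₁ _)
  obtain ⟨w, hw, hwB⟩ := steinerD_exists_root_arc hB₂ ⟨H, hH⟩ (hU₂ _)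
  have hwB₁ : Sum.inl w ∉ B₁ := fun h => Finset.disjoint_left.mp hdisj h hwB
  exact ⟨v, hv, w, hw, by simp [hvB, hwB₁]⟩
end

section
/- Let H_k = (V_k, E_k) be a k-uniform hypergraph, let D_k be the directed graph with vertex set V_k ∪ U_k ∪ {s}, where U_k has one vertex u_H for each hyperedge H ∈ E_k, with arcs A_k consisting of an arc s→v for every v ∈ V_k and an arc v→u_H for every v ∈ V_k, H ∈ E_k with v ∈ H. Let D_k* be obtained from D_k by adding a set A_k* of k−1 parallel arcs from s to v for every v ∈ V_k, and define τ_k*(a) = 1 for a ∈ A_k and τ_k*(a) = 2 for a ∈ A_k*. Then a spanning s-arborescence F* of D_k* is τ_k*-respecting if and only if F* − A_k* (the subgraph of F* formed by its arcs belonging to A_k) is an (s, U_k)-arborescence of D_k. -/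
instance steinerArcDecEq {Vk : Type} [DecidableEq Vk] (E : Finset (Finset Vk)) :
    DecidableEq (Vk ⊕ {p : Vk × {H : Finset Vk // H ∈ E} // p.1 ∈ p.2.1}) := by
  infer_instance

/-- `D_k*` : `D_k` together with the extra arc set `A_k*` consisting of `k-1` parallel
arcs `s → v` for every hypergraph vertex `v` (the arcs `Sum.inr (v, _)`). -/
def steinerDstar {Vk : Type} [DecidableEq Vk] (E : Finset (Finset Vk)) (k : ℕ) :
    Dgraph (Option (Vk ⊕ {H : Finset Vk // H ∈ E}))
      ((Vk ⊕ {p : Vk × {H : Finset Vk // H ∈ E} // p.1 ∈ p.2.1}) ⊕ (Vk × Fin (k - 1))) where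
  tail a :=
    match a with
    | Sum.inl a => (steinerD E).tail a
    | Sum.inr _ => none
  head a :=
    match a with
    | Sum.inl a => (steinerD E).head a
    | Sum.inr p => some (Sum.inl p.1)

/-- The time labels `τ_k*` on `D_k*` : value `1` on the arcs of `D_k`, value `2` on the
added parallel arcs `A_k*`. -/
def tauStar {Vk : Type} [DecidableEq Vk] (E : Finset (Finset Vk)) (k : ℕ) :
    ((Vk ⊕ {p : Vk × {H : Finset Vk // H ∈ E} // p.1 ∈ p.2.1}) ⊕ (Vk × Fin (k - 1))) → ℕ :=
  fun a => match a with
  | Sum.inl _ => 1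
  | Sum.inr _ => 2

theorem Dgraph.mem_vertsF {Vt At : Type} [DecidableEq Vt] [Fintype At] (D : Dgraph Vt At)
    (s v : Vt) (B : Finset At) :
    v ∈ D.vertsF s B ↔ v = s ∨ (∃ a ∈ B, D.tail a = v) ∨ ∃ a ∈ B, D.head a = v := by
  simp [Dgraph.vertsF]

theorem Dgraph.indegOn_eq_one_iff {Vt At : Type} [DecidableEq Vt] [Fintype At]
    (D : Dgraph Vt At) (B : Finset At) (v : Vt) :
    D.indegOn B v = 1 ↔ ∃ a ∈ B, D.head a = v ∧ ∀ b ∈ B, D.head b = v → b = a := by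
  unfold Dgraph.indegOn
  rw [Finset.card_eq_one]
  constructor
  · rintro ⟨a, ha⟩
    have h : ∀ b, (b ∈ B ∧ D.head b = v) ↔ b = a := fun b => by
      rw [← Finset.mem_singleton (a := a), ← ha, Finset.mem_filter]
    obtain ⟨h1, h2⟩ := (h a).2 rfl
    exact ⟨a, h1, h2, fun b hb hv => (h b).1 ⟨hb, hv⟩⟩
  · rintro ⟨a, ha, hav, huniq⟩
    refine ⟨a, Finset.ext fun b => ?_⟩
    rw [Finset.mem_filter, Finset.mem_singleton]
    exact ⟨fun h => huniq b h.1 h.2, fun h => h ▸ ⟨ha, hav⟩⟩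

theorem Dgraph.respects_iff_isChain {At : Type} (τ : At → ℕ) (p : List At) :
    Dgraph.Respects τ p ↔ List.IsChain (· ≤ ·) (p.map τ) :=
  Iff.rfl

theorem steinerDstar_walkFrom_map_inl {Vk : Type} [DecidableEq Vk] (E : Finset (Finset Vk))
    (k : ℕ) (p : List (Vk ⊕ {p : Vk × {H : Finset Vk // H ∈ E} // p.1 ∈ p.2.1}))
    (u v : Option (Vk ⊕ {H : Finset Vk // H ∈ E})) (h : (steinerD E).WalkFrom u p v) :
    (steinerDstar E k).WalkFrom u (p.map Sum.inl) v := by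
  induction p generalizing u with
  | nil => exact h
  | cons a p ih => exact ⟨h.1, ih _ h.2⟩

/-- Walks of `D_k*` from the root have at most two arcs, the second one being an arc `v → u_H`. -/
theorem steinerDstar_walkFrom_none {Vk : Type} [DecidableEq Vk] (E : Finset (Finset Vk)) (k : ℕ)
    (p : List ((Vk ⊕ {p : Vk × {H : Finset Vk // H ∈ E} // p.1 ∈ p.2.1}) ⊕ (Vk × Fin (k - 1))))
    (v : Option (Vk ⊕ {H : Finset Vk // H ∈ E})) (h : (steinerDstar E k).WalkFrom none p v) :
    p = [] ∨ (∃ a, p = [a]) ∨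
      ∃ a q, p = [a, Sum.inl (Sum.inr q)] ∧
        (steinerDstar E k).head a = some (Sum.inl q.1.1) := by
  match p, h with
  | [], _ => exact Or.inl rfl
  | [a], _ => exact Or.inr (Or.inl ⟨a, rfl⟩)
  | a :: b :: l, ⟨ha, hb, hl⟩ =>
    refine Or.inr (Or.inr ?_)
    rcases b with (w | q) | i
    · rcases a with (w' | q') | i' <;> simp [steinerDstar, steinerD] at ha hb
    · match l, hl with
      | [], _ => exact ⟨a, q, rfl, hb.symm⟩
      | c :: l, ⟨hc, _⟩ =>
        rcases c with (w' | q') | i' <;> simp [steinerDstar, steinerD] at hc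
    · rcases a with (w' | q') | i' <;> simp [steinerDstar, steinerD] at ha hb

/-- For a `k`-uniform hypergraph `H_k`, a spanning `s`-arborescence `F*` of
`D_k*` is `τ_k*`-respecting if and only if `F* − A_k*` (the arcs of `F*` lying in `A_k`)
is an `(s, U_k)`-arborescence of `D_k`. -/
theorem spanning_tarb_iff_steiner
    {Vk : Type} [Fintype Vk] [DecidableEq Vk] (k : ℕ) (E : Finset (Finset Vk))
    (hunif : ∀ H ∈ E, H.card = k)
    (B : Finset ((Vk ⊕ {p : Vk × {H : Finset Vk // H ∈ E} // p.1 ∈ p.2.1}) ⊕ (Vk × Fin (k - 1))))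
    (harb : (steinerDstar E k).IsArb none B)
    (hspan : (steinerDstar E k).vertsF none B = Finset.univ) :
    (steinerDstar E k).IsTArb (tauStar E k) none B ↔
      ((steinerD E).IsArb none
          (Finset.univ.filter
            (fun a : Vk ⊕ {p : Vk × {H : Finset Vk // H ∈ E} // p.1 ∈ p.2.1} =>
              Sum.inl a ∈ B)) ∧
        ∀ u : {H : Finset Vk // H ∈ E},
          some (Sum.inr u) ∈
            (steinerD E).vertsF none
              (Finset.univ.filter
                (fun a : Vk ⊕ {p : Vk × {H : Finset Vk // H ∈ E} // p.1 ∈ p.2.1} =>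
                  Sum.inl a ∈ B))) := by
  have huniq : ∀ a ∈ B, ∀ b ∈ B, (steinerDstar E k).head a = (steinerDstar E k).head b →
      (steinerDstar E k).head a ≠ none → a = b := by
    intro a ha b hb hab hne
    obtain ⟨c, -, -, hc⟩ := ((steinerDstar E k).indegOn_eq_one_iff B _).1
      (harb.2 _ (by rw [hspan]; exact Finset.mem_univ _) hne)
    rw [hc a ha rfl, hc b hb hab.symm]
  have hin : ∀ v, v ≠ none → ∃ a ∈ B, (steinerDstar E k).head a = v := by
    intro v hv
    obtain ⟨a, ha, hav, -⟩ := ((steinerDstar E k).indegOn_eq_one_iff B v).1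
      (harb.2 v (by rw [hspan]; exact Finset.mem_univ _) hv)
    exact ⟨a, ha, hav⟩
  have hinr : ∀ u : {H : Finset Vk // H ∈ E}, ∃ a, Sum.inl a ∈ B ∧
      (steinerD E).head a = some (Sum.inr u) := by
    intro u
    obtain ⟨a, ha, hav⟩ := hin (some (Sum.inr u)) (by simp)
    rcases a with a | i
    · exact ⟨a, ha, hav⟩
    · simp [steinerDstar] at hav
  constructor
  · rintro ⟨-, hresp⟩
    refine ⟨⟨?_, ?_⟩, ?_⟩
    · rintro ⟨v, p, hp, hpB, hw⟩
      refine harb.1 ⟨v, p.map Sum.inl, by simpa using hp, ?_,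
        steinerDstar_walkFrom_map_inl E k p v v hw⟩
      intro a ha
      obtain ⟨b, hb, rfl⟩ := List.mem_map.1 ha
      simpa using hpB b hb
    · intro v hv hne
      have hex : ∃ a, Sum.inl a ∈ B ∧ (steinerD E).head a = v := by
        rcases ((steinerD E).mem_vertsF none v _).1 hv with h | ⟨a, ha, hav⟩ | ⟨a, ha, hav⟩
        · exact absurd h hne
        · replace ha : Sum.inl a ∈ B := by simpa using ha
          rcases a with w | q
          · exact absurd hav.symm hne
          · obtain ⟨b, hb, hbv⟩ := hin v hne
            rcases b with b | i
            · exact ⟨b, hb, hbv⟩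
            · have hh : some (Sum.inl i.1) = some (Sum.inl q.1.1) := hbv.trans hav.symm
              have hr := hresp (some (Sum.inr q.1.2)) (by rw [hspan]; exact Finset.mem_univ _)
                [Sum.inr i, Sum.inl (Sum.inr q)] (by simp [hb, ha])
                ⟨⟨rfl, hh.symm, rfl⟩, by simp [Dgraph.walkVerts, steinerDstar, steinerD]⟩
              simp [Dgraph.respects_iff_isChain, tauStar] at hr
        · exact ⟨a, by simpa using ha, hav⟩
      obtain ⟨a, ha, hav⟩ := hex
      refine ((steinerD E).indegOn_eq_one_iff _ v).2 ⟨a, by simpa using ha, hav, ?_⟩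
      intro b hb hbv
      exact Sum.inl_injective (huniq (Sum.inl b) (by simpa using hb) (Sum.inl a) ha
        (hbv.trans hav.symm) (fun h => hne (hbv.symm.trans h)))
    · intro u
      obtain ⟨a, ha, hau⟩ := hinr u
      exact ((steinerD E).mem_vertsF none _ _).2 (Or.inr (Or.inr ⟨a, by simpa using ha, hau⟩))
  · rintro ⟨⟨-, hdeg⟩, -⟩
    refine ⟨harb, fun v _ p hpB hp => ?_⟩
    rcases steinerDstar_walkFrom_none E k p v hp.1 with rfl | ⟨a, rfl⟩ | ⟨a, q, rfl, haq⟩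
    · simp [Dgraph.respects_iff_isChain]
    · simp [Dgraph.respects_iff_isChain]
    · have hq : Sum.inl (Sum.inr q) ∈ B := hpB _ (by simp)
      rcases a with a | i
      · simp [Dgraph.respects_iff_isChain, tauStar]
      · obtain ⟨c, hc, hcv, -⟩ := ((steinerD E).indegOn_eq_one_iff _ _).1
          (hdeg (some (Sum.inl q.1.1))
            (((steinerD E).mem_vertsF none _ _).2
              (Or.inr (Or.inl ⟨Sum.inr q, by simpa using hq, rfl⟩))) (by simp))
        have h := huniq (Sum.inr i) (hpB _ (by simp)) (Sum.inl c) (by simpa using hc)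
          (haq.trans hcv.symm) (by rw [haq]; simp)
        exact absurd h (by simp)
end

section
/- Let D be a directed graph containing two distinct vertices r and t, and let D' be obtained from D by adding a new vertex s together with the two arcs s→r and s→t. Then D contains a directed (r,t)-path and a directed (t,r)-path that are arc-disjoint if and only if D' contains a packing of 2 (s, {r,t})-arborescences. -/
/-- The directed graph `D'` obtained from `D` by adding a new vertex `s` (`none`) together
with the two arcs `s → r` (`Sum.inr false`) and `s → t` (`Sum.inr true`). -/
def addRoot {Vt At : Type} (D : Dgraph Vt At) (r t : Vt) :
    Dgraph (Option Vt) (At ⊕ Bool) where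
  tail a :=
    match a with
    | Sum.inl a => some (D.tail a)
    | Sum.inr _ => none
  head a :=
    match a with
    | Sum.inl a => some (D.head a)
    | Sum.inr b => some (if b then t else r)

namespace Dgraph

variable {Vt At : Type} {D : Dgraph Vt At}

theorem WalkFrom.append {u v w : Vt} {p q : List At} (hp : D.WalkFrom u p v)
    (hq : D.WalkFrom v q w) : D.WalkFrom u (p ++ q) w := by
  induction p generalizing u with
  | nil => cases hp; exact hq
  | cons a p ih => exact ⟨hp.1, ih hp.2⟩

theorem WalkFrom.exists_prefix {u v x : Vt} {p : List At} (hp : D.WalkFrom u p v)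
    (hx : x ∈ D.walkVerts u p) : ∃ q, q ⊆ p ∧ D.WalkFrom u q x := by
  induction p generalizing u with
  | nil => exact ⟨[], by simp, by simpa [walkVerts, WalkFrom, eq_comm] using hx⟩
  | cons a p ih =>
    rcases List.mem_cons.1 hx with rfl | hx
    · exact ⟨[], by simp, rfl⟩
    · obtain ⟨q, hqp, hq⟩ := ih hp.2 hx
      exact ⟨a :: q, List.cons_subset_cons a hqp, hp.1, hq⟩

theorem WalkFrom.end_mem_walkVerts {u v : Vt} {p : List At} (hp : D.WalkFrom u p v) :
    v ∈ D.walkVerts u p := by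
  induction p generalizing u with
  | nil => cases hp; simp [walkVerts]
  | cons a p ih => exact List.mem_cons_of_mem _ (ih hp.2)

theorem WalkFrom.tail_mem_walkVerts {u v : Vt} {p : List At} (hp : D.WalkFrom u p v) {a : At}
    (ha : a ∈ p) : D.tail a ∈ D.walkVerts u p := by
  induction p generalizing u with
  | nil => cases ha
  | cons b p ih =>
    rcases List.mem_cons.1 ha with rfl | ha
    · exact hp.1 ▸ List.mem_cons_self
    · exact List.mem_cons_of_mem _ (ih hp.2 ha)

theorem WalkFrom.tail_mem_heads_of_closed {u : Vt} {p : List At} (hp : D.WalkFrom u p u) {a : At}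
    (ha : a ∈ p) : D.tail a ∈ p.map D.head := by
  rcases List.mem_cons.1 (hp.tail_mem_walkVerts ha) with h | h
  · cases p with
    | nil => cases ha
    | cons b p => exact h ▸ hp.2.end_mem_walkVerts
  · exact h

theorem AcyclicOn.nodup_walkVerts {B : Set At} (hB : D.AcyclicOn B) {u v : Vt} {p : List At}
    (hp : D.WalkFrom u p v) (hpB : ∀ a ∈ p, a ∈ B) : (D.walkVerts u p).Nodup := by
  induction p generalizing u with
  | nil => simp [walkVerts]
  | cons a p ih =>
    refine List.nodup_cons.2 ⟨fun hu => hB ?_, ih hp.2 fun b hb => hpB b (List.mem_cons_of_mem _ hb)⟩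
    obtain ⟨q, hqp, hq⟩ := hp.2.exists_prefix hu
    exact ⟨u, a :: q, by simp, fun b hb => hpB b (List.cons_subset_cons a hqp hb), hp.1, hq⟩

theorem IsPath.acyclicOn {u v : Vt} {p : List At} (hp : D.IsPath u p v) :
    D.AcyclicOn {a | a ∈ p} := by
  induction p generalizing u with
  | nil =>
    rintro ⟨w, c, hc, hcp, -⟩
    exact hc (List.eq_nil_iff_forall_not_mem.2 fun a ha => List.not_mem_nil (hcp a ha))
  | cons a p ih =>
    obtain ⟨⟨hau, hw⟩, hnd⟩ := hp
    obtain ⟨hu, hnd⟩ := List.nodup_cons.1 hnd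
    rintro ⟨w, c, hc, hcp, hcw⟩
    refine ih ⟨hw, hnd⟩ ⟨w, c, hc, fun b hb => ?_, hcw⟩
    rcases List.mem_cons.1 (hcp b hb) with rfl | h
    · obtain ⟨d, hd, hdu⟩ := List.mem_map.1 (hcw.tail_mem_heads_of_closed hb)
      exact absurd (List.mem_map.2 ⟨d, hcp d hd, hdu.trans hau⟩) hu
    · exact h

theorem AcyclicOn.wellFounded [Finite Vt] {B : Set At} (hB : D.AcyclicOn B) :
    WellFounded fun x y => ∃ a ∈ B, D.tail a = x ∧ D.head a = y := by
  set R : Vt → Vt → Prop := fun x y => ∃ a ∈ B, D.tail a = x ∧ D.head a = y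
  have walk : ∀ x y, Relation.TransGen R x y →
      ∃ p, p ≠ [] ∧ (∀ a ∈ p, a ∈ B) ∧ D.WalkFrom x p y := by
    intro x y h
    induction h with
    | single h =>
      obtain ⟨a, ha, hx, hy⟩ := h
      exact ⟨[a], by simp, by simpa using ha, hx, hy⟩
    | tail _ h ih =>
      obtain ⟨a, ha, hx, hy⟩ := h
      obtain ⟨p, hp, hpB, hw⟩ := ih
      refine ⟨p ++ [a], by simp, ?_, hw.append ⟨hx, hy⟩⟩
      simp only [List.mem_append, List.mem_singleton]
      rintro b (hb | rfl)
      exacts [hpB b hb, ha]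
  have : Std.Irrefl (Relation.TransGen R) := ⟨fun x h => hB ⟨x, walk x x h⟩⟩
  exact Subrelation.wf Relation.TransGen.single
    (Finite.wellFounded_of_trans_of_irrefl (Relation.TransGen R))

section Arborescence

variable [DecidableEq Vt]

theorem WalkFrom.mem_vertsF_iff [DecidableEq At] {u v w : Vt} {p : List At}
    (hp : D.WalkFrom u p v) : w ∈ D.vertsF u p.toFinset ↔ w ∈ D.walkVerts u p := by
  simp only [vertsF, Finset.mem_insert, Finset.mem_union, Finset.mem_image, List.mem_toFinset]
  constructor
  · rintro (rfl | ⟨a, ha, rfl⟩ | ⟨a, ha, rfl⟩)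
    · exact List.mem_cons_self
    · exact hp.tail_mem_walkVerts ha
    · exact List.mem_cons_of_mem _ (List.mem_map_of_mem ha)
  · intro h
    rcases List.mem_cons.1 h with h | h
    · exact Or.inl h
    · exact Or.inr (Or.inr (List.mem_map.1 h))

theorem IsPath.isArb [DecidableEq At] {u v : Vt} {p : List At} (hp : D.IsPath u p v) :
    D.IsArb u p.toFinset := by
  refine ⟨by simpa [AcyclicOn] using hp.acyclicOn, fun w hw hwu => ?_⟩
  obtain ⟨a, ha, rfl⟩ := List.mem_map.1
    ((List.mem_cons.1 (hp.1.mem_vertsF_iff.1 hw)).resolve_left hwu)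
  refine Finset.card_eq_one.2 ⟨a, Finset.ext fun b => ?_⟩
  simp only [Finset.mem_filter, List.mem_toFinset, Finset.mem_singleton]
  constructor
  · rintro ⟨hb, hba⟩
    exact List.inj_on_of_nodup_map (List.nodup_cons.1 hp.2).2 hb ha hba
  · rintro rfl
    exact ⟨ha, rfl⟩

theorem IsArb.exists_walk [Finite Vt] {s v : Vt} {B : Finset At} (hB : D.IsArb s B)
    (hv : v ∈ D.vertsF s B) : ∃ p, (∀ a ∈ p, a ∈ B) ∧ D.WalkFrom s p v := by
  induction v using hB.1.wellFounded.induction with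
  | _ v ih =>
  by_cases hvs : v = s
  · exact ⟨[], by simp, hvs.symm⟩
  · have hpos : 0 < D.indegOn B v := by rw [hB.2 v hv hvs]; exact one_pos
    obtain ⟨a, ha⟩ := Finset.card_pos.1 hpos
    obtain ⟨haB, hav⟩ := Finset.mem_filter.1 ha
    have hta : D.tail a ∈ D.vertsF s B := Finset.mem_insert_of_mem
      (Finset.mem_union_left _ (Finset.mem_image_of_mem _ haB))
    obtain ⟨p, hpB, hp⟩ := ih _ ⟨a, haB, rfl, hav⟩ hta
    refine ⟨p ++ [a], ?_, hp.append ⟨rfl, hav⟩⟩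
    simp only [List.mem_append, List.mem_singleton]
    rintro b (hb | rfl)
    exacts [hpB b hb, haB]

end Arborescence

section AddRoot

variable {r t : Vt}

theorem walkFrom_addRoot_map_inl {u v : Vt} {p : List At} :
    (addRoot D r t).WalkFrom (some u) (p.map Sum.inl) (some v) ↔ D.WalkFrom u p v := by
  induction p generalizing u with
  | nil => exact Option.some_inj
  | cons a p ih => exact and_congr Option.some_inj ih

theorem WalkFrom.exists_eq_map_inl {u v : Vt} {p : List (At ⊕ Bool)}
    (hp : (addRoot D r t).WalkFrom (some u) p (some v)) : ∃ q : List At, p = q.map Sum.inl := by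
  induction p generalizing u with
  | nil => exact ⟨[], rfl⟩
  | cons a p ih =>
    rcases a with a | b
    · obtain ⟨q, rfl⟩ := ih hp.2
      exact ⟨a :: q, rfl⟩
    · cases hp.1

theorem AcyclicOn.of_addRoot {B : Set (At ⊕ Bool)} (hB : (addRoot D r t).AcyclicOn B) :
    D.AcyclicOn {a | Sum.inl a ∈ B} := by
  rintro ⟨v, p, hp, hpB, hw⟩
  exact hB ⟨some v, p.map Sum.inl, by simpa using hp, by simpa using hpB,
    walkFrom_addRoot_map_inl.2 hw⟩

theorem IsPath.cons_root {u v : Vt} {p : List At} (hp : D.IsPath u p v) {b : Bool}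
    (hb : (if b then t else r) = u) :
    (addRoot D r t).IsPath none (Sum.inr b :: p.map Sum.inl) (some v) := by
  subst hb
  refine ⟨⟨rfl, walkFrom_addRoot_map_inl.2 hp.1⟩, ?_⟩
  have h : (addRoot D r t).walkVerts none (Sum.inr b :: p.map Sum.inl) =
      none :: (D.walkVerts (if b then t else r) p).map some := by
    simp only [walkVerts, addRoot, List.map_cons, List.map_map]
    rfl
  rw [h]
  exact List.nodup_cons.2 ⟨by simp, hp.2.map (Option.some_injective _)⟩

variable [DecidableEq Vt]

theorem IsArb.exists_path_of_addRoot [Finite Vt] {B : Finset (At ⊕ Bool)}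
    (hB : (addRoot D r t).IsArb none B) {v : Vt}
    (hv : some v ∈ (addRoot D r t).vertsF none B) :
    ∃ b : Bool, Sum.inr b ∈ B ∧
      ∃ p, (∀ a ∈ p, Sum.inl a ∈ B) ∧ D.IsPath (if b then t else r) p v := by
  obtain ⟨p, hpB, hp⟩ := hB.exists_walk hv
  match p, hpB, hp with
  | [], _, hp => cases hp
  | Sum.inl a :: p, _, hp => cases hp.1
  | Sum.inr b :: p, hpB, hp =>
    obtain ⟨q, rfl⟩ := WalkFrom.exists_eq_map_inl hp.2
    have hq : ∀ a ∈ q, Sum.inl a ∈ B := fun a ha =>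
      hpB _ (List.mem_cons_of_mem _ (List.mem_map_of_mem ha))
    have hw := walkFrom_addRoot_map_inl.1 hp.2
    exact ⟨b, hpB _ List.mem_cons_self, q, hq, hw, hB.1.of_addRoot.nodup_walkVerts hw hq⟩

theorem IsArb.exists_path_between_terminals [Finite Vt] {B : Finset (At ⊕ Bool)}
    (hB : (addRoot D r t).IsArb none B)
    (hr : some r ∈ (addRoot D r t).vertsF none B) (ht : some t ∈ (addRoot D r t).vertsF none B) :
    ∃ b : Bool, Sum.inr b ∈ B ∧ (Sum.inr (!b) ∉ B →
      ∃ p, (∀ a ∈ p, Sum.inl a ∈ B) ∧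
        D.IsPath (if b then t else r) p (if b then r else t)) := by
  obtain ⟨b, hb, p, hpB, hp⟩ := hB.exists_path_of_addRoot hr
  cases b
  · refine ⟨false, hb, fun hnb => ?_⟩
    obtain ⟨c, hc, q, hqB, hq⟩ := hB.exists_path_of_addRoot ht
    cases c
    · exact ⟨q, hqB, hq⟩
    · exact absurd hc hnb
  · exact ⟨true, hb, fun _ => ⟨p, hpB, hp⟩⟩

theorem IsPath.exists_isArb_addRoot [DecidableEq At] {u v : Vt} {p : List At}
    (hp : D.IsPath u p v) {b : Bool} (hb : (if b then t else r) = u) :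
    (addRoot D r t).IsArb none (Sum.inr b :: p.map Sum.inl).toFinset ∧
      some u ∈ (addRoot D r t).vertsF none (Sum.inr b :: p.map Sum.inl).toFinset ∧
      some v ∈ (addRoot D r t).vertsF none (Sum.inr b :: p.map Sum.inl).toFinset := by
  have h := hp.cons_root hb
  exact ⟨h.isArb, h.1.mem_vertsF_iff.2 (by simp [walkVerts, addRoot, hb]),
    h.1.mem_vertsF_iff.2 h.1.end_mem_walkVerts⟩

end AddRoot

end Dgraph

/-- `D` contains an `(r,t)`-path and a `(t,r)`-path that are arc-disjoint
if and only if `D'` (obtained from `D` by adding a new root `s` and the arcs `s → r`,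
`s → t`) contains a packing of `2` `(s, {r,t})`-arborescences. -/
theorem arc_disjoint_paths_iff_two_steiner_arbs
    {Vt At : Type} [Fintype Vt] [DecidableEq Vt] [Fintype At] [DecidableEq At]
    (D : Dgraph Vt At) (r t : Vt) (hrt : r ≠ t) :
    (∃ p q : List At, D.IsPath r p t ∧ D.IsPath t q r ∧ ∀ a ∈ p, a ∉ q) ↔
      (∃ B₁ B₂ : Finset (At ⊕ Bool), Disjoint B₁ B₂ ∧
        (addRoot D r t).IsArb none B₁ ∧
        some r ∈ (addRoot D r t).vertsF none B₁ ∧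
        some t ∈ (addRoot D r t).vertsF none B₁ ∧
        (addRoot D r t).IsArb none B₂ ∧
        some r ∈ (addRoot D r t).vertsF none B₂ ∧
        some t ∈ (addRoot D r t).vertsF none B₂) := by
  constructor
  · rintro ⟨p, q, hp, hq, hpq⟩
    obtain ⟨hA, hAr, hAt⟩ := hp.exists_isArb_addRoot (r := r) (t := t) (b := false) rfl
    obtain ⟨hB, hBt, hBr⟩ := hq.exists_isArb_addRoot (r := r) (t := t) (b := true) rfl
    refine ⟨_, _, ?_, hA, hAr, hAt, hB, hBr, hBt⟩
    rw [Finset.disjoint_left]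
    rintro (a | b) ha hb
    · simp only [List.mem_toFinset, List.mem_cons, List.mem_map, Sum.inl.injEq, exists_eq_right,
        reduceCtorEq, false_or] at ha hb
      exact hpq a ha hb
    · simp at ha hb
      simp [ha] at hb
  · rintro ⟨B₁, B₂, hdisj, hB₁, hr₁, ht₁, hB₂, hr₂, ht₂⟩
    obtain ⟨b, hb, hpath₁⟩ := hB₁.exists_path_between_terminals hr₁ ht₁
    obtain ⟨c, hc, hpath₂⟩ := hB₂.exists_path_between_terminals hr₂ ht₂
    rw [Finset.disjoint_left] at hdisj
    obtain rfl : c = !b := by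
      rw [Bool.eq_not_iff]
      rintro rfl
      exact hdisj hb hc
    obtain ⟨p, hpB, hp⟩ := hpath₁ fun h => hdisj h hc
    obtain ⟨q, hqB, hq⟩ := hpath₂ fun h => hdisj hb (by simpa using h)
    cases b
    · exact ⟨p, q, hp, hq, fun a hap haq => hdisj (hpB a hap) (hqB a haq)⟩
    · exact ⟨q, p, hq, hp, fun a haq hap => hdisj (hpB a hap) (hqB a haq)⟩
end

section
/- Let H = (V, E) be a 3-regular 3-uniform hypergraph with vertices V = {v_1, …, v_h} and hyperedges E = {H_1, …, H_h}. Construct the directed graph D = (Z ∪ {s}, A) with Z = U ∪ V ∪ W, where U = {u_1, …, u_h}, W = {w_{i,j} : i < j, H_i ∩ H_j ≠ ∅}, and A = A_1 ∪ A_2 ∪ A_3 ∪ A_4 with A_1 = {s→u_i : 1 ≤ i ≤ h}, A_2 a second set of parallel arcs {s→u_i : 1 ≤ i ≤ h}, A_3 = {u_i→v_j : v_j ∈ H_i}, and A_4 = {u_i→w_{i,j}, u_j→w_{i,j} : w_{i,j} ∈ W}; color the arcs of A_1 ∪ A_3 black and the arcs of A_2 ∪ A_4 grey. Then H has an exact cover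 if and only if D has a spanning s-arborescence in which every directed path is monochromatic. -/
/-- The index set `W` of the construction: pairs `i < j` of hyperedge indices whose
hyperedges intersect. -/
def rxcW (h : ℕ) (Hs : Fin h → Finset (Fin h)) : Type :=
  {p : Fin h × Fin h // p.1 < p.2 ∧ (Hs p.1 ∩ Hs p.2).Nonempty}

instance (h : ℕ) (Hs : Fin h → Finset (Fin h)) : Fintype (rxcW h Hs) :=
  Subtype.fintype _

instance (h : ℕ) (Hs : Fin h → Finset (Fin h)) : DecidableEq (rxcW h Hs) :=
  Subtype.instDecidableEq

/-- The arc type of the construction: `A₁` (black arcs `s → u_i`), `A₂` (grey arcs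
`s → u_i`), `A₃` (black arcs `u_i → v_j` for `v_j ∈ H_i`) and `A₄` (grey arcs
`u_i → w_{i,j}` and `u_j → w_{i,j}`). -/
def rxcA (h : ℕ) (Hs : Fin h → Finset (Fin h)) : Type :=
  (Fin h ⊕ Fin h) ⊕ ({p : Fin h × Fin h // p.2 ∈ Hs p.1} ⊕ rxcW h Hs × Bool)

instance (h : ℕ) (Hs : Fin h → Finset (Fin h)) : Fintype (rxcA h Hs) := by
  unfold rxcA; infer_instance

instance (h : ℕ) (Hs : Fin h → Finset (Fin h)) : DecidableEq (rxcA h Hs) := by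
  unfold rxcA rxcW; exact inferInstance

/-- The vertex type of the construction: the root `s` is `none`; `some (Sum.inl (Sum.inl i))`
is `u_i`, `some (Sum.inl (Sum.inr j))` is `v_j`, and `some (Sum.inr w)` is `w_{i,j}`. -/
def rxcZ (h : ℕ) (Hs : Fin h → Finset (Fin h)) : Type :=
  Option ((Fin h ⊕ Fin h) ⊕ rxcW h Hs)

instance (h : ℕ) (Hs : Fin h → Finset (Fin h)) : Fintype (rxcZ h Hs) := by
  unfold rxcZ; infer_instance

instance (h : ℕ) (Hs : Fin h → Finset (Fin h)) : DecidableEq (rxcZ h Hs) := by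
  unfold rxcZ rxcW; exact inferInstance

/-- The directed graph `D` of the construction. -/
def rxcD (h : ℕ) (Hs : Fin h → Finset (Fin h)) : Dgraph (rxcZ h Hs) (rxcA h Hs) where
  tail a :=
    match a with
    | Sum.inl (Sum.inl _) => none
    | Sum.inl (Sum.inr _) => none
    | Sum.inr (Sum.inl p) => some (Sum.inl (Sum.inl p.1.1))
    | Sum.inr (Sum.inr (w, b)) => some (Sum.inl (Sum.inl (if b then w.1.2 else w.1.1)))
  head a :=
    match a with
    | Sum.inl (Sum.inl i) => some (Sum.inl (Sum.inl i))
    | Sum.inl (Sum.inr i) => some (Sum.inl (Sum.inl i))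
    | Sum.inr (Sum.inl p) => some (Sum.inl (Sum.inr p.1.2))
    | Sum.inr (Sum.inr (w, _)) => some (Sum.inr w)

/-- The 2-coloring of the arcs: `true` (black) on `A₁ ∪ A₃`, `false` (grey) on `A₂ ∪ A₄`. -/
def rxcColor (h : ℕ) (Hs : Fin h → Finset (Fin h)) : rxcA h Hs → Bool :=
  fun a => match a with
  | Sum.inl (Sum.inl _) => true
  | Sum.inl (Sum.inr _) => false
  | Sum.inr (Sum.inl _) => true
  | Sum.inr (Sum.inr _) => false

theorem Finset.card_filter_eq_one_iff {α : Type*} (s : Finset α) (p : α → Prop)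
    [DecidablePred p] : (s.filter p).card = 1 ↔ ∃! a, a ∈ s ∧ p a := by
  simp only [Finset.card_eq_one, Finset.singleton_iff_unique_mem, Finset.mem_filter]

namespace Dgraph

variable {Vt At : Type}

theorem WalkFrom.le_rank {D : Dgraph Vt At} {r : Vt → ℕ}
    (hr : ∀ a, r (D.tail a) < r (D.head a)) :
    ∀ {p : List At} {u v : Vt}, D.WalkFrom u p v → r u + p.length ≤ r v
  | [], _, _, h => by cases h; simp
  | a :: p, u, v, ⟨ht, hw⟩ => by
    have h₁ := hw.le_rank hr
    have h₂ := hr a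
    rw [ht] at h₂
    rw [List.length_cons]
    omega

/-- A directed graph whose arcs all increase a rank function has no directed cycle. -/
theorem acyclicOn_of_rank {D : Dgraph Vt At} (r : Vt → ℕ)
    (hr : ∀ a, r (D.tail a) < r (D.head a)) (B : Set At) : D.AcyclicOn B := by
  rintro ⟨v, p, hp, -, hw⟩
  have h₁ := hw.le_rank hr
  have h₂ := List.length_pos_of_ne_nil hp
  omega

theorem WalkFrom.color_eq {D : Dgraph Vt At} {c : At → Bool} {B : Set At}
    (hc : ∀ a ∈ B, ∀ b ∈ B, D.head a = D.tail b → c a = c b) :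
    ∀ {p : List At} {a : At} {v : Vt}, a ∈ B → (∀ b ∈ p, b ∈ B) →
      D.WalkFrom (D.head a) p v → ∀ b ∈ p, c b = c a
  | [], _, _, _, _, _ => by simp
  | b :: p, a, v, ha, hp, ⟨ht, hw⟩ => by
    have hb : b ∈ B := hp b List.mem_cons_self
    have hab : c a = c b := hc a ha b hb ht.symm
    intro d hd
    rcases List.mem_cons.1 hd with rfl | hd
    · exact hab.symm
    · rw [hab]
      exact hw.color_eq hc hb (fun x hx => hp x (List.mem_cons_of_mem _ hx)) d hd

/-- If consecutive arcs of `B` have equal colours, every walk inside `B` is monochromatic. -/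
theorem WalkFrom.monochromatic {D : Dgraph Vt At} {c : At → Bool} {B : Set At}
    (hc : ∀ a ∈ B, ∀ b ∈ B, D.head a = D.tail b → c a = c b)
    {p : List At} {u v : Vt} (hp : ∀ a ∈ p, a ∈ B) (hw : D.WalkFrom u p v) :
    Monochromatic c p := by
  cases p with
  | nil => simp [Monochromatic]
  | cons a p =>
    have key : ∀ b ∈ a :: p, c b = c a := by
      intro b hb
      rcases List.mem_cons.1 hb with rfl | hb
      · rfl
      · exact hw.2.color_eq hc (hp a List.mem_cons_self)
          (fun x hx => hp x (List.mem_cons_of_mem _ hx)) b hb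
    intro x hx y hy
    rw [key x hx, key y hy]

theorem indegOn_eq_one_iff_s19 [DecidableEq Vt] [Fintype At] (D : Dgraph Vt At) (B : Finset At)
    (v : Vt) : D.indegOn B v = 1 ↔ ∃! a, a ∈ B ∧ D.head a = v :=
  Finset.card_filter_eq_one_iff B _

theorem vertsF_eq_univ [DecidableEq Vt] [Fintype Vt] [Fintype At] {D : Dgraph Vt At} {s : Vt}
    {B : Finset At} (hB : ∀ v, v ≠ s → D.indegOn B v = 1) : D.vertsF s B = Finset.univ := by
  refine Finset.eq_univ_iff_forall.2 fun v => ?_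
  by_cases hv : v = s
  · simp [vertsF, hv]
  · obtain ⟨a, ⟨ha, rfl⟩, -⟩ := (D.indegOn_eq_one_iff_s19 B v).1 (hB v hv)
    exact Finset.mem_insert_of_mem (Finset.mem_union_right _ (Finset.mem_image_of_mem _ ha))

end Dgraph

section ExactCover

variable {h : ℕ} {Hs : Fin h → Finset (Fin h)}

/-- The distance of a vertex of the construction from the root. -/
def rxcRank (h : ℕ) (Hs : Fin h → Finset (Fin h)) : rxcZ h Hs → ℕ
  | none => 0
  | some (Sum.inl (Sum.inl _)) => 1
  | some (Sum.inl (Sum.inr _)) => 2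
  | some (Sum.inr _) => 2

theorem rxcRank_tail_lt_head (a : rxcA h Hs) :
    rxcRank h Hs ((rxcD h Hs).tail a) < rxcRank h Hs ((rxcD h Hs).head a) := by
  rcases a with (i | i) | p | ⟨w, b⟩ <;> simp [rxcD, rxcRank]

/-- Membership in the arborescence of an exact cover `E'`: the arc entering `u_i` is black iff
`i ∈ E'`, each `v_j` is entered from a member of `E'` and each `w_{i,j}` from `u_i`, unless
`i ∈ E'`, when it is entered from `u_j`. -/
def rxcMemArb (E' : Finset (Fin h)) : rxcA h Hs → Prop
  | Sum.inl (Sum.inl i) => i ∈ E'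
  | Sum.inl (Sum.inr i) => i ∉ E'
  | Sum.inr (Sum.inl p) => p.1.1 ∈ E'
  | Sum.inr (Sum.inr (w, b)) => b = decide (w.1.1 ∈ E')

theorem rxcMemArb_existsUnique {E' : Finset (Fin h)}
    (hE : ∀ v, ∃! i, i ∈ E' ∧ v ∈ Hs i) (v : rxcZ h Hs) (hv : v ≠ none) :
    ∃! a, rxcMemArb E' a ∧ (rxcD h Hs).head a = v := by
  rcases v with _ | (i | j) | w
  · exact absurd rfl hv
  · by_cases hi : i ∈ E'
    · refine ⟨Sum.inl (Sum.inl i), ⟨hi, rfl⟩, ?_⟩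
      rintro ((k | k) | p | ⟨w, b⟩) ⟨hk, hh⟩ <;> cases hh
      · rfl
      · exact absurd hi hk
    · refine ⟨Sum.inl (Sum.inr i), ⟨hi, rfl⟩, ?_⟩
      rintro ((k | k) | p | ⟨w, b⟩) ⟨hk, hh⟩ <;> cases hh
      · exact absurd hk hi
      · rfl
  · obtain ⟨i, ⟨hi, hj⟩, huniq⟩ := hE j
    refine ⟨Sum.inr (Sum.inl ⟨(i, j), hj⟩), ⟨hi, rfl⟩, ?_⟩
    rintro ((k | k) | ⟨⟨k, l⟩, hl⟩ | ⟨w, b⟩) ⟨hk, hh⟩ <;> cases hh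
    obtain rfl := huniq k ⟨hk, hl⟩
    rfl
  · refine ⟨Sum.inr (Sum.inr (w, decide (w.1.1 ∈ E'))), ⟨rfl, rfl⟩, ?_⟩
    rintro ((k | k) | p | ⟨w, b⟩) ⟨hk, hh⟩ <;> cases hh
    cases hk
    rfl

theorem rxcMemArb_color_eq {E' : Finset (Fin h)} (hE : ∀ v, ∃! i, i ∈ E' ∧ v ∈ Hs i)
    (a b : rxcA h Hs) (ha : rxcMemArb E' a) (hb : rxcMemArb E' b)
    (hab : (rxcD h Hs).head a = (rxcD h Hs).tail b) : rxcColor h Hs a = rxcColor h Hs b := by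
  have hw : ∀ w : rxcW h Hs, ∀ c : Bool, c = decide (w.1.1 ∈ E') →
      (if c then w.1.2 else w.1.1) ∉ E' := by
    rintro ⟨⟨i, j⟩, hlt, v, hv⟩ c rfl
    rw [Finset.mem_inter] at hv
    by_cases hi : i ∈ E'
    · simpa [hi] using fun hj => hlt.ne ((hE v).unique ⟨hi, hv.1⟩ ⟨hj, hv.2⟩)
    · simp [hi]
  rcases a with (i | i) | p | ⟨w, c⟩ <;> rcases b with (j | j) | q | ⟨w', d⟩ <;> cases hab
  · rfl
  · exact absurd ha (hw w' d hb)
  · exact absurd hb ha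
  · rfl

theorem exists_arborescence_of_exactCover {E' : Finset (Fin h)}
    (hE : ∀ v, ∃! i, i ∈ E' ∧ v ∈ Hs i) :
    ∃ B : Finset (rxcA h Hs),
      (rxcD h Hs).IsArb none B ∧
      (rxcD h Hs).vertsF none B = Finset.univ ∧
      ∀ (u v : rxcZ h Hs) (p : List (rxcA h Hs)),
        (∀ a ∈ p, a ∈ B) → (rxcD h Hs).IsPath u p v →
          Dgraph.Monochromatic (rxcColor h Hs) p := by
  classical
  let B : Finset (rxcA h Hs) := Finset.univ.filter (rxcMemArb E')
  have hB : ∀ a, a ∈ B ↔ rxcMemArb E' a := by simp [B]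
  have hdeg : ∀ v : rxcZ h Hs, v ≠ none → (rxcD h Hs).indegOn B v = 1 := by
    intro v hv
    simpa only [Dgraph.indegOn_eq_one_iff_s19, hB] using rxcMemArb_existsUnique hE v hv
  refine ⟨B, ⟨Dgraph.acyclicOn_of_rank (rxcRank h Hs) rxcRank_tail_lt_head _,
    fun v _ hv => hdeg v hv⟩, Dgraph.vertsF_eq_univ hdeg, fun u v p hp hpath => ?_⟩
  exact hpath.1.monochromatic (B := {a | rxcMemArb E' a})
    (fun a ha b hb => rxcMemArb_color_eq hE a b ha hb) fun a ha => (hB a).1 (hp a ha)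

theorem color_eq_of_consecutive {B : Finset (rxcA h Hs)}
    (hmono : ∀ (u v : rxcZ h Hs) (p : List (rxcA h Hs)), (∀ a ∈ p, a ∈ B) →
      (rxcD h Hs).IsPath u p v → Dgraph.Monochromatic (rxcColor h Hs) p)
    {a b : rxcA h Hs} (ha : a ∈ B) (hb : b ∈ B)
    (hab : (rxcD h Hs).head a = (rxcD h Hs).tail b) : rxcColor h Hs a = rxcColor h Hs b := by
  have h₁ := rxcRank_tail_lt_head a
  have h₂ := rxcRank_tail_lt_head b
  refine hmono ((rxcD h Hs).tail a) ((rxcD h Hs).head b) [a, b] (by simp [ha, hb])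
    ⟨⟨rfl, hab.symm, rfl⟩, ?_⟩ a (by simp) b (by simp)
  rw [← hab] at h₂
  refine List.Nodup.of_map (rxcRank h Hs) ?_
  simp [Dgraph.walkVerts]
  omega

theorem exists_exactCover_of_arborescence {B : Finset (rxcA h Hs)}
    (hdeg : ∀ v : rxcZ h Hs, v ≠ none → ∃! a, a ∈ B ∧ (rxcD h Hs).head a = v)
    (hmono : ∀ (u v : rxcZ h Hs) (p : List (rxcA h Hs)), (∀ a ∈ p, a ∈ B) →
      (rxcD h Hs).IsPath u p v → Dgraph.Monochromatic (rxcColor h Hs) p) :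
    ∃ E' : Finset (Fin h), ∀ v, ∃! i, i ∈ E' ∧ v ∈ Hs i := by
  classical
  let black (i : Fin h) : rxcA h Hs := Sum.inl (Sum.inl i)
  have hdisj : ∀ i j v, i < j → black i ∈ B → black j ∈ B → v ∈ Hs i → v ∉ Hs j := by
    intro i j v hij hi hj hvi hvj
    let w : rxcW h Hs := ⟨(i, j), hij, v, Finset.mem_inter.2 ⟨hvi, hvj⟩⟩
    obtain ⟨a, ⟨ha, hh⟩, -⟩ := hdeg (some (Sum.inr w)) (Option.some_ne_none _)
    rcases a with (k | k) | p | ⟨w', b⟩ <;> cases hh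
    cases b
    · exact Bool.noConfusion (color_eq_of_consecutive hmono hi ha rfl)
    · exact Bool.noConfusion (color_eq_of_consecutive hmono hj ha rfl)
  refine ⟨Finset.univ.filter fun i => black i ∈ B, fun v => ?_⟩
  simp only [Finset.mem_filter, Finset.mem_univ, true_and]
  obtain ⟨a, ⟨ha, hh⟩, -⟩ := hdeg (some (Sum.inl (Sum.inr v))) (Option.some_ne_none _)
  rcases a with (k | k) | ⟨⟨i, j⟩, hij⟩ | ⟨w', b⟩ <;> cases hh
  have hi : black i ∈ B := by
    obtain ⟨c, ⟨hc, hh⟩, -⟩ := hdeg (some (Sum.inl (Sum.inl i))) (Option.some_ne_none _)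
    rcases c with (k | k) | p | ⟨w', b⟩ <;> cases hh
    · exact hc
    · exact Bool.noConfusion (color_eq_of_consecutive hmono hc ha rfl)
  refine ⟨i, ⟨hi, hij⟩, fun k ⟨hk, hvk⟩ => ?_⟩
  rcases lt_trichotomy k i with hlt | rfl | hlt
  · exact absurd hij (hdisj k i _ hlt hk hi hvk)
  · rfl
  · exact absurd hvk (hdisj i k _ hlt hi hk hij)

end ExactCover

/-- Let `H = (V, E)` be a 3-regular 3-uniform hypergraph with `h` vertices
`v₁, …, v_h` and `h` (distinct) hyperedges `H₁, …, H_h`. Then `H` has an exact cover if and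
only if the constructed 2-arc-colored directed graph `D` has a spanning `s`-arborescence
in which every directed path is monochromatic. -/
theorem exact_cover_iff_monochromatic_spanning_arborescence
    (h : ℕ) (Hs : Fin h → Finset (Fin h))
    (hinj : Function.Injective Hs)
    (hunif : ∀ i : Fin h, (Hs i).card = 3)
    (hreg : ∀ v : Fin h, (Finset.univ.filter (fun i => v ∈ Hs i)).card = 3) :
    (∃ E' : Finset (Fin h), ∀ v : Fin h, (E'.filter (fun i => v ∈ Hs i)).card = 1) ↔
      (∃ B : Finset (rxcA h Hs),
        (rxcD h Hs).IsArb none B ∧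
        (rxcD h Hs).vertsF none B = Finset.univ ∧
        ∀ (u v : rxcZ h Hs) (p : List (rxcA h Hs)),
          (∀ a ∈ p, a ∈ B) → (rxcD h Hs).IsPath u p v →
            Dgraph.Monochromatic (rxcColor h Hs) p) := by
  simp only [Finset.card_filter_eq_one_iff]
  constructor
  · rintro ⟨E', hE⟩
    exact exists_arborescence_of_exactCover hE
  · rintro ⟨B, ⟨-, hdeg⟩, hspan, hmono⟩
    refine exists_exactCover_of_arborescence (fun v hv => ?_) hmono
    exact ((rxcD h Hs).indegOn_eq_one_iff_s19 B v).1 (hdeg v (hspan ▸ Finset.mem_univ v) hv)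
end
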